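/- arXiv:2007.09229 — 2 statements merged into one kernel-verified Lean document; each statement's English description precedes it below -/
import Mathlib

section
/- Let α be a weak composition with all parts ≥ 1 avoiding all patterns in KM, and let γ, τ ∈ lswap(α) with γ >_lex τ. If T is a quasi-key tableau of shape γ and S is a quasi-key tableau of shape τ, then wt(T) ≠ wt(S). -/
open Finset

/-- `α` (on indices `1..n`) contains the composition pattern `β`. -/
def Contains (n : ℕ) (α : ℕ → ℕ) (β : List ℕ) : Prop :=
  ∃ j : Fin β.length → ℕ, StrictMono j ∧ (∀ s, 1 ≤ j s ∧ j s ≤ n) ∧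
    (∀ s t, α (j s) ≤ α (j t) ↔ β.get s ≤ β.get t) ∧
    (∀ s t, |(β.get s : ℤ) - (β.get t : ℤ)| ≤ |(α (j s) : ℤ) - (α (j t) : ℤ)|)

/-- `α` avoids all five patterns in `KM`. -/
def AvoidsKM (n : ℕ) (α : ℕ → ℕ) : Prop :=
  ∀ β ∈ [[0,1,2], [0,0,2,2], [0,0,2,1], [1,0,3,2], [1,0,2,2]], ¬ Contains n α β

/-- `(i, j)` is a box of the skyline diagram `D(α)`. -/
def InD (n : ℕ) (α : ℕ → ℕ) (i j : ℕ) : Prop :=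
  1 ≤ i ∧ i ≤ n ∧ 1 ≤ j ∧ j ≤ α i

/-- `T` is a quasi-key tableau of shape `α` (rules QKT1–QKT4). -/
structure IsQKT (n : ℕ) (α : ℕ → ℕ) (T : ℕ → ℕ → ℕ) : Prop where
  pos : ∀ i j, InD n α i j → 1 ≤ T i j
  rowDec : ∀ i j j', InD n α i j → InD n α i j' → j ≤ j' → T i j' ≤ T i j
  rowBound : ∀ i j, InD n α i j → T i j ≤ i
  colDistinct : ∀ i i' j, InD n α i j → InD n α i' j → i ≠ i' → T i j ≠ T i' j
  firstColInc : ∀ i i', InD n α i 1 → InD n α i' 1 → i < i' → T i 1 < T i' 1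
  qkt3 : ∀ r r' c, InD n α r c → InD n α r' c → r < r' → T r' c < T r c →
      InD n α r (c + 1) ∧ T r' c < T r (c + 1)
  qkt4 : ∀ r s c, r < s → α r < α s → InD n α r c → InD n α s (c + 1) →
      T r c < T s (c + 1)

/-- The boxes of the skyline diagram `D(α)` as a finite set. -/
def Boxes (n : ℕ) (α : ℕ → ℕ) : Finset (ℕ × ℕ) :=
  (Finset.Icc 1 n).biUnion (fun i => (Finset.Icc 1 (α i)).image (fun j => (i, j)))

/-- The number of entries of the filling `T` equal to `v`. -/
def wtOf (n : ℕ) (α : ℕ → ℕ) (T : ℕ → ℕ → ℕ) (v : ℕ) : ℕ :=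
  ((Boxes n α).filter (fun x => T x.1 x.2 = v)).card

/-- `β` is obtained from `α` by a single left swap. -/
def LeftSwapped (n : ℕ) (α β : ℕ → ℕ) : Prop :=
  ∃ i j, 1 ≤ i ∧ i < j ∧ j ≤ n ∧ α i < α j ∧ β i = α j ∧ β j = α i ∧
    ∀ t, t ≠ i → t ≠ j → β t = α t

/-- `γ ∈ lswap(α)`: `γ` is obtained from `α` by a sequence of left swaps. -/
def InLSwap (n : ℕ) (α γ : ℕ → ℕ) : Prop :=
  Relation.ReflTransGen (LeftSwapped n) α γ

/-- `γ >_lex τ` on the entries indexed `1..n`. -/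
def LexGT (n : ℕ) (γ τ : ℕ → ℕ) : Prop :=
  ∃ b, 1 ≤ b ∧ b ≤ n ∧ (∀ s, 1 ≤ s → s < b → γ s = τ s) ∧ τ b < γ b

def lowC (σ : ℕ → ℕ) (k v : ℕ) : ℕ := ((Finset.Icc 1 k).filter (fun i => σ i < v)).card
def upC (σ : ℕ → ℕ) (k v : ℕ) : ℕ := ((Finset.Icc 1 k).filter (fun i => v ≤ σ i)).card
def tailC (n : ℕ) (σ : ℕ → ℕ) (k v : ℕ) : ℕ :=
  ((Finset.Ioc k n).filter (fun i => v ≤ σ i)).card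

lemma low_up (σ : ℕ → ℕ) (k v : ℕ) : lowC σ k v + upC σ k v = k := by
  have h := Finset.card_filter_add_card_filter_not (s := Finset.Icc 1 k) (fun i => σ i < v)
  simp only [not_lt, Nat.card_Icc, Nat.add_sub_cancel] at h
  exact h

lemma Icc_split {k n : ℕ} (hk : k ≤ n) : Finset.Icc 1 n = Finset.Icc 1 k ∪ Finset.Ioc k n := by
  ext i; simp only [Finset.mem_Icc, Finset.mem_union, Finset.mem_Ioc]; omega

lemma Icc_disj (k n : ℕ) : Disjoint (Finset.Icc 1 k) (Finset.Ioc k n) := by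
  rw [Finset.disjoint_left]; intro i; simp only [Finset.mem_Icc, Finset.mem_Ioc]; omega

lemma up_tail (n : ℕ) (σ : ℕ → ℕ) (k v : ℕ) (hk : k ≤ n) :
    upC σ n v = upC σ k v + tailC n σ k v := by
  unfold upC tailC
  rw [Icc_split hk, Finset.filter_union, Finset.card_union_of_disjoint]
  exact Finset.disjoint_filter_filter (Icc_disj k n)

lemma swap_sum_ge {n : ℕ} {α β : ℕ → ℕ} (i j : ℕ) (hi : 1 ≤ i) (hij : i < j)
    (hbi : β i = α j) (hbj : β j = α i) (ho : ∀ t, t ≠ i → t ≠ j → β t = α t)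
    (f : ℕ → ℕ) (hj : j ≤ n) :
    ∑ x ∈ Finset.Icc 1 n, f (α x) = ∑ x ∈ Finset.Icc 1 n, f (β x) := by
  refine Finset.sum_equiv (Equiv.swap i j) ?_ ?_
  · intro x
    rcases eq_or_ne x i with rfl | h1
    · simp only [Equiv.swap_apply_left, Finset.mem_Icc]; omega
    rcases eq_or_ne x j with rfl | h2
    · simp only [Equiv.swap_apply_right, Finset.mem_Icc]; omega
    rw [Equiv.swap_apply_of_ne_of_ne h1 h2]
  · intro x _
    rcases eq_or_ne x i with rfl | h1
    · simp [hbj]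
    rcases eq_or_ne x j with rfl | h2
    · simp [hbi]
    rw [Equiv.swap_apply_of_ne_of_ne h1 h2, ho x h1 h2]

lemma tot_sum {n : ℕ} {α γ : ℕ → ℕ} (h : InLSwap n α γ) (f : ℕ → ℕ) :
    ∑ x ∈ Finset.Icc 1 n, f (α x) = ∑ x ∈ Finset.Icc 1 n, f (γ x) := by
  induction h with
  | refl => rfl
  | tail _ h2 ih =>
    obtain ⟨i, j, hi, hij, hj, _, hbi, hbj, ho⟩ := h2
    exact ih.trans (swap_sum_ge i j hi hij hbi hbj ho f hj)

lemma up_sum (σ : ℕ → ℕ) (k v : ℕ) :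
    upC σ k v = ∑ x ∈ Finset.Icc 1 k, (fun y => if v ≤ y then 1 else 0) (σ x) := by
  unfold upC; rw [Finset.card_filter]

lemma up_tot {n : ℕ} {α γ : ℕ → ℕ} (h : InLSwap n α γ) (v : ℕ) : upC α n v = upC γ n v := by
  rw [up_sum, up_sum]; exact tot_sum h (fun y => if v ≤ y then 1 else 0)

lemma up_le {n : ℕ} {α γ : ℕ → ℕ} (h : InLSwap n α γ) (k v : ℕ) : upC α k v ≤ upC γ k v := by
  induction h with
  | refl => exact le_rfl
  | tail _ h2 ih =>
    obtain ⟨i, j, hi, hij, hj, hlt, hbi, hbj, ho⟩ := h2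
    refine ih.trans ?_
    by_cases hk : j ≤ k
    · rw [up_sum, up_sum]; exact (swap_sum_ge i j hi hij hbi hbj ho
        (fun y => if v ≤ y then 1 else 0) hk).le
    · refine Finset.card_le_card ?_
      intro x
      simp only [Finset.mem_filter, Finset.mem_Icc]
      rintro ⟨hx, hv⟩
      refine ⟨hx, ?_⟩
      rcases eq_or_ne x i with rfl | h1
      · omega
      · rw [ho x h1 (by omega)]; exact hv

lemma low_le {n : ℕ} {α γ : ℕ → ℕ} (h : InLSwap n α γ) (k v : ℕ) : lowC γ k v ≤ lowC α k v := by
  have := up_le h k v; have := low_up α k v; have := low_up γ k v; omega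

lemma tail_le {n : ℕ} {α γ : ℕ → ℕ} (h : InLSwap n α γ) (k v : ℕ) (hk : k ≤ n) :
    tailC n γ k v ≤ tailC n α k v := by
  have := up_le h k v; have := up_tail n α k v hk; have := up_tail n γ k v hk
  have := up_tot h v; omega

lemma low_pos {σ : ℕ → ℕ} {k v : ℕ} : 0 < lowC σ k v ↔ ∃ x, 1 ≤ x ∧ x ≤ k ∧ σ x < v := by
  unfold lowC; rw [Finset.card_pos]
  simp only [Finset.Nonempty, Finset.mem_filter, Finset.mem_Icc, and_assoc]

lemma low_two {σ : ℕ → ℕ} {k v : ℕ} : 1 < lowC σ k v ↔ ∃ x y, 1 ≤ x ∧ x ≤ k ∧ σ x < v ∧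
    1 ≤ y ∧ y ≤ k ∧ σ y < v ∧ x ≠ y := by
  unfold lowC; rw [Finset.one_lt_card]
  simp only [Finset.mem_filter, Finset.mem_Icc]
  constructor
  · rintro ⟨a, ⟨⟨h1, h2⟩, h3⟩, b, ⟨⟨h4, h5⟩, h6⟩, h7⟩; exact ⟨a, b, h1, h2, h3, h4, h5, h6, h7⟩
  · rintro ⟨a, b, h1, h2, h3, h4, h5, h6, h7⟩; exact ⟨a, ⟨⟨h1, h2⟩, h3⟩, b, ⟨⟨h4, h5⟩, h6⟩, h7⟩

lemma tail_pos {n : ℕ} {σ : ℕ → ℕ} {k v : ℕ} :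
    0 < tailC n σ k v ↔ ∃ x, k < x ∧ x ≤ n ∧ v ≤ σ x := by
  unfold tailC; rw [Finset.card_pos]
  simp only [Finset.Nonempty, Finset.mem_filter, Finset.mem_Ioc, and_assoc]

lemma tail_two {n : ℕ} {σ : ℕ → ℕ} {k v : ℕ} : 1 < tailC n σ k v ↔ ∃ x y, k < x ∧ x ≤ n ∧ v ≤ σ x ∧
    k < y ∧ y ≤ n ∧ v ≤ σ y ∧ x ≠ y := by
  unfold tailC; rw [Finset.one_lt_card]
  simp only [Finset.mem_filter, Finset.mem_Ioc]
  constructor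
  · rintro ⟨a, ⟨⟨h1, h2⟩, h3⟩, b, ⟨⟨h4, h5⟩, h6⟩, h7⟩; exact ⟨a, b, h1, h2, h3, h4, h5, h6, h7⟩
  · rintro ⟨a, b, h1, h2, h3, h4, h5, h6, h7⟩; exact ⟨a, ⟨⟨h1, h2⟩, h3⟩, b, ⟨⟨h4, h5⟩, h6⟩, h7⟩

/-! Pattern avoidance -/

def PA (n : ℕ) (α : ℕ → ℕ) : Prop :=
  ∀ i j k, 1 ≤ i → i < j → j < k → k ≤ n → α i < α j → α j < α k → False

def PB (n : ℕ) (α : ℕ → ℕ) : Prop :=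
  ∀ i j k l, 1 ≤ i → 1 ≤ j → i < k → i < l → j < k → j < l → i ≠ j → k ≠ l → k ≤ n → l ≤ n →
    α i < α k → α i < α l → α j < α k → α j < α l →
    α i = α j ∧ α k = α l ∧ α k = α i + 1

lemma contains3 {n : ℕ} {α : ℕ → ℕ} {i j k x y z : ℕ} (h1 : 1 ≤ i) (h2 : i < j) (h3 : j < k)
    (h4 : k ≤ n)
    (hc : ∀ s t : Fin 3, α (![i, j, k] s) ≤ α (![i, j, k] t) ↔ ![x, y, z] s ≤ ![x, y, z] t)
    (hd : ∀ s t : Fin 3, |(![x, y, z] s : ℤ) - (![x, y, z] t : ℤ)| ≤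
      |(α (![i, j, k] s) : ℤ) - (α (![i, j, k] t) : ℤ)|) :
    Contains n α [x, y, z] := by
  refine ⟨![i, j, k], ?_, ?_, ?_, ?_⟩
  · intro a b hab
    fin_cases a <;> fin_cases b <;> simp at hab ⊢ <;> omega
  · intro s; fin_cases s <;> simp <;> omega
  · intro s t
    have := hc s t
    fin_cases s <;> fin_cases t <;> simpa using this
  · intro s t
    have := hd s t
    fin_cases s <;> fin_cases t <;> simpa using this

lemma contains4 {n : ℕ} {α : ℕ → ℕ} {i j k l x y z w : ℕ} (h1 : 1 ≤ i) (h2 : i < j) (h3 : j < k)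
    (h4 : k < l) (h5 : l ≤ n)
    (hc : ∀ s t : Fin 4, α (![i, j, k, l] s) ≤ α (![i, j, k, l] t) ↔
      ![x, y, z, w] s ≤ ![x, y, z, w] t)
    (hd : ∀ s t : Fin 4, |(![x, y, z, w] s : ℤ) - (![x, y, z, w] t : ℤ)| ≤
      |(α (![i, j, k, l] s) : ℤ) - (α (![i, j, k, l] t) : ℤ)|) :
    Contains n α [x, y, z, w] := by
  refine ⟨![i, j, k, l], ?_, ?_, ?_, ?_⟩
  · intro a b hab
    fin_cases a <;> fin_cases b <;> simp at hab ⊢ <;> omega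
  · intro s; fin_cases s <;> simp <;> omega
  · intro s t
    have := hc s t
    fin_cases s <;> fin_cases t <;> simpa using this
  · intro s t
    have := hd s t
    fin_cases s <;> fin_cases t <;> simpa using this

lemma pa_of {n : ℕ} {α : ℕ → ℕ} (h : AvoidsKM n α) : PA n α := by
  intro i j k h1 h2 h3 h4 h5 h6
  refine h [0,1,2] (by simp) (contains3 h1 h2 h3 h4 ?_ ?_)
  · intro s t; fin_cases s <;> fin_cases t <;> simp <;> omega
  · intro s t; fin_cases s <;> fin_cases t <;> simp <;> rw [le_abs] <;> omega

lemma pb0 {n : ℕ} {α : ℕ → ℕ} (h : AvoidsKM n α) {i j k l : ℕ} (h1 : 1 ≤ i) (h2 : i < j)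
    (h3 : j < k) (h4 : k < l) (h5 : l ≤ n)
    (e1 : α i < α k) (e2 : α i < α l) (e3 : α j < α k) (e4 : α j < α l) :
    α i = α j ∧ α k = α l ∧ α k = α i + 1 := by
  have hA := pa_of h
  have a1 : α j ≤ α i := by
    by_contra hh; exact hA i j k h1 h2 h3 (by omega) (by omega) e3
  have a2 : α l ≤ α k := by
    by_contra hh; exact hA j k l (by omega) h3 h4 h5 e3 (by omega)
  by_contra hcon
  rcases Nat.lt_or_ge (α j) (α i) with b1 | b1
  · rcases Nat.lt_or_ge (α l) (α k) with b2 | b2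
    · refine h [1,0,3,2] (by simp) (contains4 h1 h2 h3 h4 h5 ?_ ?_)
      · intro s t; fin_cases s <;> fin_cases t <;> simp <;> omega
      · intro s t; fin_cases s <;> fin_cases t <;> simp <;> rw [le_abs] <;> omega
    · refine h [1,0,2,2] (by simp) (contains4 h1 h2 h3 h4 h5 ?_ ?_)
      · intro s t; fin_cases s <;> fin_cases t <;> simp <;> omega
      · intro s t; fin_cases s <;> fin_cases t <;> simp <;> rw [le_abs] <;> omega
  · rcases Nat.lt_or_ge (α l) (α k) with b2 | b2
    · refine h [0,0,2,1] (by simp) (contains4 h1 h2 h3 h4 h5 ?_ ?_)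
      · intro s t; fin_cases s <;> fin_cases t <;> simp <;> omega
      · intro s t; fin_cases s <;> fin_cases t <;> simp <;> rw [le_abs] <;> omega
    · refine h [0,0,2,2] (by simp) (contains4 h1 h2 h3 h4 h5 ?_ ?_)
      · intro s t; fin_cases s <;> fin_cases t <;> simp <;> omega
      · intro s t; fin_cases s <;> fin_cases t <;> simp <;> rw [le_abs] <;> omega

lemma pb_of {n : ℕ} {α : ℕ → ℕ} (h : AvoidsKM n α) : PB n α := by
  intro i j k l h1 h2 h3 h4 h5 h6 h7 h8 h9 h10 e1 e2 e3 e4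
  rcases lt_or_gt_of_ne h7 with a | a <;> rcases lt_or_gt_of_ne h8 with b | b
  · exact pb0 h h1 a h5 b h10 e1 e2 e3 e4
  · have := pb0 h h1 a h6 b h9 e2 e1 e4 e3; omega
  · have := pb0 h h2 a h3 b h10 e3 e4 e1 e2; omega
  · have := pb0 h h2 a h4 b h9 e4 e3 e2 e1; omega

/-! Tableaux -/

lemma mem_Boxes {n : ℕ} {α : ℕ → ℕ} {x : ℕ × ℕ} : x ∈ Boxes n α ↔ InD n α x.1 x.2 := by
  obtain ⟨i, j⟩ := x
  simp only [Boxes, InD, Finset.mem_biUnion, Finset.mem_image, Finset.mem_Icc, Prod.mk.injEq]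
  constructor
  · rintro ⟨a, ⟨h1, h2⟩, c, ⟨h3, h4⟩, rfl, rfl⟩; exact ⟨h1, h2, h3, h4⟩
  · rintro ⟨h1, h2, h3, h4⟩; exact ⟨i, ⟨h1, h2⟩, j, ⟨h3, h4⟩, rfl, rfl⟩

lemma card_Boxes (k : ℕ) (α : ℕ → ℕ) : (Boxes k α).card = ∑ i ∈ Finset.Icc 1 k, α i := by
  unfold Boxes
  rw [Finset.card_biUnion]
  · refine Finset.sum_congr rfl fun i _ => ?_
    rw [Finset.card_image_of_injective _ (fun a b h => by simpa using h)]; simp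
  · intro a _ b _ hab
    simp only [Function.onFun]
    rw [Finset.disjoint_left]
    simp only [Finset.mem_image]
    rintro x ⟨c, _, rfl⟩ ⟨d, _, h⟩
    simp only [Prod.mk.injEq] at h
    exact hab h.1.symm

def PC (n : ℕ) (α : ℕ → ℕ) (T : ℕ → ℕ → ℕ) (k : ℕ) : ℕ :=
  ((Boxes n α).filter (fun x => T x.1 x.2 ≤ k)).card

lemma PC_eq (n : ℕ) (α : ℕ → ℕ) (T : ℕ → ℕ → ℕ) (k : ℕ) :
    PC n α T k = ∑ v ∈ Finset.range (k + 1), wtOf n α T v := by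
  unfold PC wtOf
  rw [Finset.card_eq_sum_card_fiberwise (f := fun x => T x.1 x.2) (t := Finset.range (k + 1))]
  · refine Finset.sum_congr rfl fun v hv => ?_
    rw [Finset.filter_filter]
    congr 1
    refine Finset.filter_congr fun x _ => ?_
    simp only [Finset.mem_range] at hv
    constructor
    · exact fun h => h.2
    · intro h; exact ⟨by omega, h⟩
  · intro x hx
    simp only [Finset.coe_filter, Set.mem_ofPred_eq] at hx
    simp only [Finset.coe_range, Set.mem_Iio]; omega

lemma PC_lower {n : ℕ} {γ : ℕ → ℕ} {T : ℕ → ℕ → ℕ} (hT : IsQKT n γ T) {k : ℕ} (hk : k ≤ n) :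
    ∑ i ∈ Finset.Icc 1 k, γ i ≤ PC n γ T k := by
  rw [← card_Boxes]
  refine Finset.card_le_card ?_
  intro x hx
  rw [mem_Boxes] at hx
  obtain ⟨h1, h2, h3, h4⟩ := hx
  have hD : InD n γ x.1 x.2 := ⟨h1, by omega, h3, h4⟩
  rw [Finset.mem_filter, mem_Boxes]
  exact ⟨hD, (hT.rowBound _ _ hD).trans h2⟩

lemma col_const {n : ℕ} {τ : ℕ → ℕ} {S : ℕ → ℕ → ℕ} (hS : IsQKT n τ S) {k c : ℕ} (hk : k ≤ n)
    (hc : 1 ≤ c) (h : ∀ i, 1 ≤ i → i ≤ k → c ≤ τ i) : ∀ i, 1 ≤ i → i ≤ k → S i c = i := by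
  intro i
  induction i using Nat.strong_induction_on with
  | _ i ih =>
    intro h1 h2
    have hD : InD n τ i c := ⟨h1, by omega, hc, h i h1 h2⟩
    have hb := hS.rowBound _ _ hD
    have hp := hS.pos _ _ hD
    by_contra hne
    have hlt : S i c < i := by omega
    have := ih (S i c) hlt hp (by omega)
    have hD' : InD n τ (S i c) c := ⟨hp, by omega, hc, h _ hp (by omega)⟩
    exact hS.colDistinct _ _ _ hD' hD (by omega) this

lemma col_next {n : ℕ} {τ : ℕ → ℕ} {S : ℕ → ℕ → ℕ} (hS : IsQKT n τ S) {k t : ℕ} (hk : k ≤ n)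
    (ht : 1 ≤ t) (h : ∀ i, 1 ≤ i → i ≤ k → t ≤ τ i) :
    ∀ i, 1 ≤ i → i ≤ n → t + 1 ≤ τ i → S i (t + 1) ≤ k → S i (t + 1) = i := by
  have hcc := col_const hS hk ht h
  intro i
  induction i using Nat.strong_induction_on with
  | _ i ih =>
    intro h1 h2 h3 h4
    have hD : InD n τ i (t + 1) := ⟨h1, h2, by omega, h3⟩
    have hb := hS.rowBound _ _ hD
    have hp := hS.pos _ _ hD
    by_contra hne
    have hlt : S i (t + 1) < i := by omega
    have hge := h _ hp h4
    rcases Nat.lt_or_ge t (τ (S i (t + 1))) with hu | hu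
    · have hD' : InD n τ (S i (t + 1)) (t + 1) := ⟨hp, by omega, by omega, hu⟩
      have hb' := hS.rowBound _ _ hD'
      have := ih _ hlt hp (by omega) hu (by omega)
      exact hS.colDistinct _ _ _ hD' hD (by omega) this
    · have hD' : InD n τ (S i (t + 1)) t := ⟨hp, by omega, ht, hge⟩
      have := hS.qkt4 (S i (t + 1)) i t hlt (by omega) hD' hD
      rw [hcc _ hp h4] at this
      omega

lemma PC_upper {n : ℕ} {τ : ℕ → ℕ} {S : ℕ → ℕ → ℕ} (hS : IsQKT n τ S) {k t g : ℕ} (hk : k ≤ n)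
    (ht : 1 ≤ t) (htg : t < g) (hlo : ∀ i, 1 ≤ i → i ≤ k → t ≤ τ i)
    (hhi : ∀ i, k < i → i ≤ n → τ i ≤ g)
    (hone : ∀ c, t + 2 ≤ c → c ≤ g → lowC τ k c ≤ 1 ∨ tailC n τ k c ≤ 1) :
    PC n τ S k + 1 ≤ ∑ i ∈ Finset.Icc 1 k, τ i + (g - t) := by
  set E := ((Boxes n τ).filter (fun x => S x.1 x.2 ≤ k)).filter (fun x => k < x.1) with hE
  have hEm : ∀ x ∈ E, InD n τ x.1 x.2 ∧ S x.1 x.2 ≤ k ∧ k < x.1 := by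
    intro x hx
    rw [hE, Finset.mem_filter, Finset.mem_filter, mem_Boxes] at hx
    exact ⟨hx.1.1, hx.1.2, hx.2⟩
  have hsub : (Boxes n τ).filter (fun x => S x.1 x.2 ≤ k) ⊆ Boxes k τ ∪ E := by
    intro x hx
    by_cases hxk : k < x.1
    · exact Finset.mem_union_right _ (Finset.mem_filter.2 ⟨hx, hxk⟩)
    · refine Finset.mem_union_left _ ?_
      rw [Finset.mem_filter, mem_Boxes] at hx
      rw [mem_Boxes]
      obtain ⟨⟨a, b, c, d⟩, _⟩ := hx
      exact ⟨a, by omega, c, d⟩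
  have h1 : PC n τ S k ≤ (Boxes k τ).card + E.card :=
    (Finset.card_le_card hsub).trans (Finset.card_union_le _ _)
  have h2 : E.card ≤ (Finset.Icc (t + 2) g).card := by
    have hcol : ∀ x ∈ E, t + 2 ≤ x.2 ∧ x.2 ≤ g := by
      intro x hx
      obtain ⟨hD, hSk, hxk⟩ := hEm x hx
      obtain ⟨a, b, c, d⟩ := id hD
      have := hhi x.1 hxk b
      refine ⟨?_, by omega⟩
      by_contra hlt
      rcases Nat.lt_or_ge t x.2 with hc | hc
      · have hx2 : x.2 = t + 1 := by omega
        rw [hx2] at hSk d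
        have := col_next hS hk ht hlo x.1 a b d hSk
        omega
      · have hp := hS.pos _ _ hD
        have hle := hlo _ hp hSk
        have := col_const hS hk c (fun i h1 h2 => hc.trans (hlo i h1 h2)) _ hp hSk
        exact hS.colDistinct _ _ _ ⟨hp, by omega, c, by omega⟩ hD (by omega) this
    refine Finset.card_le_card_of_injOn (fun x => x.2) ?_ ?_
    · intro x hx
      have := hcol x hx
      simp only [Finset.coe_Icc, Set.mem_Icc]; exact this
    · rintro ⟨j, c⟩ hx ⟨j', c'⟩ hy hcc
      simp only at hcc
      subst hcc
      have hx' := hcol _ hx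
      obtain ⟨hD, hSk, hxk⟩ := hEm _ hx
      obtain ⟨hD', hSk', hxk'⟩ := hEm _ hy
      simp only at hx' hD hSk hxk hD' hSk' hxk'
      obtain ⟨a, b, e, d⟩ := id hD
      obtain ⟨a', b', e', d'⟩ := id hD'
      by_contra hne
      have hjj : j ≠ j' := fun h => hne (by rw [h])
      rcases hone c hx'.1 hx'.2 with ho | ho
      · have hlu := low_up τ k c
        set F := (Finset.Icc 1 k).filter (fun i => c ≤ τ i) with hF
        have hFc : F.card = upC τ k c := rfl
        have hj'F : j' ∉ F := by
          rw [hF, Finset.mem_filter, Finset.mem_Icc]; omega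
        have hjF : j ∉ insert j' F := by
          rw [Finset.mem_insert, hF, Finset.mem_filter, Finset.mem_Icc]; omega
        have hcard : (insert j (insert j' F)).card = upC τ k c + 2 := by
          rw [Finset.card_insert_of_notMem hjF, Finset.card_insert_of_notMem hj'F, hFc]
        have hall : ∀ i ∈ insert j (insert j' F), InD n τ i c ∧ S i c ≤ k := by
          intro i hi
          rw [Finset.mem_insert, Finset.mem_insert, hF, Finset.mem_filter, Finset.mem_Icc] at hi
          rcases hi with rfl | rfl | ⟨⟨p, q⟩, r⟩
          · exact ⟨hD, hSk⟩
          · exact ⟨hD', hSk'⟩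
          · have : InD n τ i c := ⟨p, by omega, e, r⟩
            exact ⟨this, (hS.rowBound _ _ this).trans q⟩
        have hle : (insert j (insert j' F)).card ≤ (Finset.Icc 1 k).card := by
          refine Finset.card_le_card_of_injOn (fun i => S i c) ?_ ?_
          · intro i hi
            obtain ⟨u, v⟩ := hall i hi
            simp only [Finset.coe_Icc, Set.mem_Icc]
            exact ⟨hS.pos _ _ u, v⟩
          · intro i hi i' hi' heq
            by_contra hn
            exact hS.colDistinct _ _ _ (hall i hi).1 (hall i' hi').1 hn heq
        rw [hcard, Nat.card_Icc] at hle
        omega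
      · have : 1 < tailC n τ k c := tail_two.2 ⟨j, j', hxk, b, d, hxk', b', d', hjj⟩
        omega
  rw [card_Boxes] at h1
  rw [Nat.card_Icc] at h2
  omega

/-! Shapes -/

lemma tau_min {n : ℕ} {α τ : ℕ → ℕ} (hA : PA n α) (hB : PB n α) (hτ : InLSwap n α τ)
    {b p g : ℕ} (hb : b ≤ n) (hbp : b < p) (hp : p ≤ n) (hg : τ p = g)
    (htg : τ b < g) : ∀ r, 1 ≤ r → r ≤ b → τ b ≤ τ r := by
  intro r hr hrb
  by_contra hlt
  push Not at hlt
  have hrb' : r < b := by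
    rcases Nat.lt_or_ge r b with h | h
    · exact h
    · have : r = b := by omega
      subst this; omega
  set t := τ b with ht
  obtain ⟨x, x1, x2, x3⟩ := low_pos.1
    (lt_of_lt_of_le (low_pos.2 ⟨r, hr, le_rfl, hlt⟩) (low_le hτ r t))
  obtain ⟨y, y1, y2, y3⟩ := tail_pos.1
    (lt_of_lt_of_le (tail_pos.2 ⟨p, hbp, hp, hg.ge⟩) (tail_le hτ b g hb))
  rcases Nat.lt_or_ge (α b) t with c1 | c1
  · -- α b < t
    have e1 : upC α b t = upC α (b - 1) t := by
      unfold upC; congr 1; ext i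
      simp only [Finset.mem_filter, Finset.mem_Icc]
      constructor
      · rintro ⟨⟨u, v⟩, w⟩
        have : i ≠ b := by rintro rfl; omega
        exact ⟨⟨u, by omega⟩, w⟩
      · rintro ⟨⟨u, v⟩, w⟩; exact ⟨⟨u, by omega⟩, w⟩
    have e2 : upC τ (b - 1) t < upC τ b t := by
      unfold upC
      refine Finset.card_lt_card ?_
      rw [Finset.ssubset_iff_of_subset]
      · refine ⟨b, ?_, ?_⟩
        · simp only [Finset.mem_filter, Finset.mem_Icc]; omega
        · simp only [Finset.mem_filter, Finset.mem_Icc]; omega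
      · intro i
        simp only [Finset.mem_filter, Finset.mem_Icc]
        rintro ⟨⟨u, v⟩, w⟩; exact ⟨⟨u, by omega⟩, w⟩
    have e3 := up_le hτ (b - 1) t
    have e4 := up_tail n α b t hb
    have e5 := up_tail n τ b t hb
    have e6 := up_tot hτ t
    have e7 : 0 < tailC n τ b t := tail_pos.2 ⟨p, hbp, hp, by omega⟩
    have e8 : 1 < tailC n α b t := by omega
    obtain ⟨u, v, u1, u2, u3, v1, v2, v3, huv⟩ := tail_two.1 e8
    have : ∃ z, b < z ∧ z ≤ n ∧ t ≤ α z ∧ z ≠ y := by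
      by_cases h : u = y
      · exact ⟨v, v1, v2, v3, by omega⟩
      · exact ⟨u, u1, u2, u3, h⟩
    obtain ⟨z, z1, z2, z3, z4⟩ := this
    have := hB x b y z x1 (by omega) (by omega) (by omega) y1 z1 (by omega) (by omega) y2 z2
      (by omega) (by omega) (by omega) (by omega)
    omega
  · rcases Nat.lt_or_ge (α b) g with c2 | c2
    · exact hA x b y x1 (by omega) y1 y2 (by omega) (by omega)
    · have : 1 < lowC α b g := lt_of_lt_of_le
        (low_two.2 ⟨r, b, hr, hrb, by omega, by omega, le_rfl, htg, by omega⟩) (low_le hτ b g)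
      obtain ⟨u, v, u1, u2, u3, v1, v2, v3, huv⟩ := low_two.1 this
      have : ∃ z, 1 ≤ z ∧ z ≤ b ∧ α z < g ∧ z ≠ x := by
        by_cases h : u = x
        · exact ⟨v, v1, v2, v3, by omega⟩
        · exact ⟨u, u1, u2, u3, h⟩
      obtain ⟨z, z1, z2, z3, z4⟩ := this
      have hzb : z ≠ b := by rintro rfl; omega
      have := hB x z b y x1 z1 (by omega) (by omega) (by omega) (by omega) (by omega) (by omega)
        hb y2 (by omega) (by omega) (by omega) (by omega)
      omega

lemma up_congr {σ ρ : ℕ → ℕ} {k v : ℕ} (h : ∀ i, 1 ≤ i → i ≤ k → (v ≤ σ i ↔ v ≤ ρ i)) :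
    upC σ k v = upC ρ k v := by
  unfold upC; congr 1
  refine Finset.filter_congr fun i hi => ?_
  rw [Finset.mem_Icc] at hi; exact h i hi.1 hi.2

/-- If the tail count beyond `b` equals `q - b` and everything is within `q`, all are large. -/
lemma tail_full {n b q v : ℕ} {σ : ℕ → ℕ} (hq : q ≤ n) (hbq : b ≤ q)
    (hc : tailC n σ b v = q - b) (hz : tailC n σ q v = 0) :
    ∀ i, b < i → i ≤ q → v ≤ σ i := by
  have hsub : (Finset.Ioc b n).filter (fun i => v ≤ σ i) ⊆ Finset.Ioc b q := by
    intro i hi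
    rw [Finset.mem_filter, Finset.mem_Ioc] at hi
    rw [Finset.mem_Ioc]
    refine ⟨hi.1.1, ?_⟩
    by_contra h
    have : 0 < tailC n σ q v := tail_pos.2 ⟨i, by omega, hi.1.2, hi.2⟩
    omega
  have heq := Finset.eq_of_subset_of_card_le hsub (by
    rw [Nat.card_Ioc]; exact hc.ge)
  intro i h1 h2
  have : i ∈ Finset.Ioc b q := Finset.mem_Ioc.2 ⟨h1, h2⟩
  rw [← heq, Finset.mem_filter] at this
  exact this.2

lemma sum_split {n b q v : ℕ} {σ : ℕ → ℕ} (hq : q ≤ n) (hbq : b ≤ q)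
    (hz : tailC n σ q v = 0) (hf : ∀ i, b < i → i ≤ q → v ≤ σ i) :
    ∑ i ∈ Finset.Icc 1 n, (fun y => if v ≤ y then y else 0) (σ i) =
      ∑ i ∈ Finset.Icc 1 b, (fun y => if v ≤ y then y else 0) (σ i) +
      ∑ i ∈ Finset.Ioc b q, σ i := by
  rw [Icc_split hq, Finset.sum_union (Icc_disj q n), Icc_split hbq, Finset.sum_union (Icc_disj b q)]
  have h1 : ∑ i ∈ Finset.Ioc q n, (fun y => if v ≤ y then y else 0) (σ i) = 0 := by
    refine Finset.sum_eq_zero fun i hi => ?_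
    rw [Finset.mem_Ioc] at hi
    have : ¬ v ≤ σ i := fun h => by
      have : 0 < tailC n σ q v := tail_pos.2 ⟨i, hi.1, hi.2, h⟩
      omega
    simp [this]
  have h2 : ∑ i ∈ Finset.Ioc b q, (fun y => if v ≤ y then y else 0) (σ i) =
      ∑ i ∈ Finset.Ioc b q, σ i := by
    refine Finset.sum_congr rfl fun i hi => ?_
    rw [Finset.mem_Ioc] at hi
    simp [hf i hi.1 hi.2]
  rw [h1, h2, add_zero]

lemma shape_key {n : ℕ} {α γ τ : ℕ → ℕ} (hA : PA n α) (hB : PB n α)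
    (hγ : InLSwap n α γ) (hτ : InLSwap n α τ) {b : ℕ} (hb1 : 1 ≤ b) (hb : b ≤ n)
    (heq : ∀ s, 1 ≤ s → s < b → γ s = τ s) (hlt : τ b < γ b) :
    ∃ k, b ≤ k ∧ k ≤ n ∧ (∀ i, 1 ≤ i → i ≤ k → τ b ≤ τ i) ∧
      (∀ i, k < i → i ≤ n → τ i ≤ γ b) ∧
      (∀ c, τ b + 2 ≤ c → c ≤ γ b → lowC τ k c ≤ 1 ∨ tailC n τ k c ≤ 1) ∧
      ∑ i ∈ Finset.Ioc b k, τ i = ∑ i ∈ Finset.Ioc b k, γ i := by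
  set t := τ b with ht
  set g := γ b with hg
  -- a position p > b with τ p = g
  have tt := fun v => up_tail n τ b v hb
  have tg := fun v => up_tail n γ b v hb
  have eτ := fun v => up_tot hτ v
  have eγ := fun v => up_tot hγ v
  have hup1 : upC τ b (g + 1) = upC γ b (g + 1) := by
    refine up_congr fun i h1 h2 => ?_
    rcases Nat.lt_or_ge i b with h | h
    · rw [heq i h1 h]
    · have : i = b := by omega
      subst this; omega
  have hup0 : upC τ b g < upC γ b g := by
    unfold upC
    refine Finset.card_lt_card ?_
    rw [Finset.ssubset_iff_of_subset]
    · refine ⟨b, ?_, ?_⟩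
      · simp only [Finset.mem_filter, Finset.mem_Icc]; omega
      · simp only [Finset.mem_filter, Finset.mem_Icc]; omega
    · intro i
      simp only [Finset.mem_filter, Finset.mem_Icc]
      rintro ⟨⟨u, v⟩, w⟩
      have : i ≠ b := by rintro rfl; omega
      rw [heq i u (by omega)]
      exact ⟨⟨u, v⟩, w⟩
  have hmono : tailC n γ b (g + 1) ≤ tailC n γ b g := by
    refine Finset.card_le_card ?_
    intro i; simp only [Finset.mem_filter]; rintro ⟨u, v⟩; exact ⟨u, by omega⟩
  have hp : ∃ p, b < p ∧ p ≤ n ∧ τ p = g := by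
    by_contra hno
    push Not at hno
    have : tailC n τ b g = tailC n τ b (g + 1) := by
      unfold tailC; congr 1
      refine Finset.filter_congr fun i hi => ?_
      rw [Finset.mem_Ioc] at hi
      have := hno i hi.1 hi.2
      omega
    have := tt g; have := tg g; have := tt (g + 1); have := tg (g + 1)
    have := eτ g; have := eγ g; have := eτ (g + 1); have := eγ (g + 1)
    omega
  obtain ⟨p, hbp, hpn, hpg⟩ := hp
  have hmin := tau_min hA hB hτ hb hbp hpn hpg hlt
  obtain ⟨x, x1, x2, x3⟩ := low_pos.1
    (lt_of_lt_of_le (low_pos.2 ⟨b, hb1, le_rfl, Nat.lt_succ_self t⟩) (low_le hτ b (t + 1)))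
  by_cases hbig : tailC n τ b (g + 1) = 0
  · refine ⟨b, le_rfl, hb, hmin, ?_, ?_, by simp⟩
    · intro i h1 h2
      by_contra h
      have : 0 < tailC n τ b (g + 1) := tail_pos.2 ⟨i, h1, h2, by omega⟩
      omega
    · intro c hc1 hc2
      by_contra hcon
      push Not at hcon
      obtain ⟨u, v, u1, u2, u3, v1, v2, v3, huv⟩ :=
        low_two.1 (lt_of_lt_of_le hcon.1 (low_le hτ b c))
      obtain ⟨j, l, j1, j2, j3, l1, l2, l3, hjl⟩ :=
        tail_two.1 (lt_of_lt_of_le hcon.2 (tail_le hτ b c hb))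
      have : ∃ z, 1 ≤ z ∧ z ≤ b ∧ α z < c ∧ z ≠ x := by
        by_cases h : u = x
        · exact ⟨v, v1, v2, v3, by omega⟩
        · exact ⟨u, u1, u2, u3, h⟩
      obtain ⟨z, z1, z2, z3, z4⟩ := this
      have := hB x z j l x1 z1 (by omega) (by omega) (by omega) (by omega) (by omega) hjl j2 l2
        (by omega) (by omega) (by omega) (by omega)
      omega
  · -- last position q of > g in α
    obtain ⟨q0, q01, q02, q03⟩ := tail_pos.1
      (lt_of_lt_of_le (Nat.pos_of_ne_zero hbig) (tail_le hτ b (g + 1) hb))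
    obtain ⟨q, hqm, hqmax⟩ : ∃ q ∈ (Finset.Ioc b n).filter (fun i => g + 1 ≤ α i),
        ∀ i ∈ (Finset.Ioc b n).filter (fun i => g + 1 ≤ α i), i ≤ q :=
      Finset.exists_max_image _ id
        ⟨q0, by rw [Finset.mem_filter, Finset.mem_Ioc]; exact ⟨⟨q01, q02⟩, q03⟩⟩
    rw [Finset.mem_filter, Finset.mem_Ioc] at hqm
    obtain ⟨⟨hbq, hqn⟩, hqg⟩ := hqm
    have hqlast : ∀ i, q < i → i ≤ n → α i ≤ g := by
      intro i h1 h2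
      by_contra h
      have := hqmax i (by rw [Finset.mem_filter, Finset.mem_Ioc]; omega)
      omega
    -- two elements ≥ g in tail of τ
    have htwo : 1 < tailC n τ b g := by
      obtain ⟨s, s1, s2, s3⟩ := tail_pos.1 (Nat.pos_of_ne_zero hbig)
      exact tail_two.2 ⟨s, p, s1, s2, by omega, hbp, hpn, by omega, by rintro rfl; omega⟩
    have htwoα : 1 < tailC n α b g := lt_of_lt_of_le htwo (tail_le hτ b g hb)
    have hp' : ∃ p', b < p' ∧ p' ≤ n ∧ α p' = g := by
      by_contra hno
      push Not at hno
      obtain ⟨j, l, j1, j2, j3, l1, l2, l3, hjl⟩ := tail_two.1 htwoα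
      have hj := hno j j1 j2
      have hl := hno l l1 l2
      have hy : ∃ y, 1 ≤ y ∧ y ≤ n ∧ α y = g := by
        by_contra hny
        push Not at hny
        have e1 : upC α n g = upC α n (g + 1) :=
          by
            unfold upC; congr 1
            refine Finset.filter_congr fun i hi => ?_
            rw [Finset.mem_Icc] at hi
            have := hny i hi.1 hi.2
            omega
        have e2 : upC τ n (g + 1) < upC τ n g := by
          unfold upC
          refine Finset.card_lt_card ?_
          rw [Finset.ssubset_iff_of_subset]
          · refine ⟨p, ?_, ?_⟩
            · simp only [Finset.mem_filter, Finset.mem_Icc]; omega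
            · simp only [Finset.mem_filter, Finset.mem_Icc]; omega
          · intro i
            simp only [Finset.mem_filter, Finset.mem_Icc]
            rintro ⟨u, w⟩; exact ⟨u, by omega⟩
        have := eτ g; have := eτ (g + 1)
        omega
      obtain ⟨y, y1, y2, y3⟩ := hy
      have hyb : y ≤ b := by
        by_contra h; exact hno y (by omega) y2 y3
      have hyx : x ≠ y := by rintro rfl; omega
      have := hB x y j l x1 y1 (by omega) (by omega) (by omega) (by omega) hyx hjl j2 l2
        (by omega) (by omega) (by omega) (by omega)
      omega
    obtain ⟨p', p1, p2, p3⟩ := hp'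
    have hqp : q < p' := by
      by_contra h
      have : p' ≠ q := by rintro rfl; omega
      exact hA x p' q x1 (by omega) (by omega) hqn (by omega) (by omega)
    have hge : ∀ i, 1 ≤ i → i ≤ q → i ≠ x → g ≤ α i := by
      intro i h1 h2 h3
      by_contra h
      have : i ≠ q := by rintro rfl; omega
      have := hB x i q p' x1 h1 (by omega) (by omega) (by omega) (by omega) (by omega) (by omega)
        hqn p2 (by omega) (by omega) (by omega) (by omega)
      omega
    have hgt : ∀ i, b < i → i ≤ q → g + 1 ≤ α i := by
      intro i h1 h2
      have := hge i (by omega) h2 (by omega)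
      by_contra h
      have : i ≠ q := by rintro rfl; omega
      exact hA x i q x1 (by omega) (by omega) hqn (by omega) (by omega)
    have hlow : lowC α q g ≤ 1 := by
      by_contra h
      push Not at h
      obtain ⟨u, v, u1, u2, u3, v1, v2, v3, huv⟩ := low_two.1 h
      have := hge u u1 u2
      have := hge v v1 v2
      omega
    have hlowτ := (low_le hτ q g).trans hlow
    have hτge : ∀ i, 1 ≤ i → i ≤ q → i ≠ b → g ≤ τ i := by
      intro i h1 h2 h3
      by_contra h
      have : 1 < lowC τ q g := low_two.2 ⟨i, b, h1, h2, by omega, hb1, by omega, hlt, h3⟩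
      omega
    -- counts
    have hαz : tailC n α q (g + 1) = 0 := by
      by_contra h
      obtain ⟨s, s1, s2, s3⟩ := tail_pos.1 (Nat.pos_of_ne_zero h)
      have := hqlast s s1 s2
      omega
    have hτz : tailC n τ q (g + 1) = 0 := by
      have := tail_le hτ q (g + 1) hqn; omega
    have hγz : tailC n γ q (g + 1) = 0 := by
      have := tail_le hγ q (g + 1) hqn; omega
    have hαc : tailC n α b (g + 1) = q - b := by
      unfold tailC
      rw [← Nat.card_Ioc]
      congr 1
      ext i
      rw [Finset.mem_filter, Finset.mem_Ioc, Finset.mem_Ioc]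
      constructor
      · rintro ⟨⟨u, v⟩, w⟩
        refine ⟨u, ?_⟩
        by_contra h
        have := hqlast i (by omega) v
        omega
      · rintro ⟨u, v⟩; exact ⟨⟨u, by omega⟩, hgt i u v⟩
    have ha := up_le hτ b (g + 1)
    have hta := up_tail n α b (g + 1) hb
    have haeq : upC α b (g + 1) = upC τ b (g + 1) := by
      by_contra hne
      have hq2 : 2 ≤ q - b := by
        have := tt (g + 1); have := eτ (g + 1); omega
      -- some y ≤ b, y ≠ x, α y = g
      have hy : ∃ y, 1 ≤ y ∧ y ≤ b ∧ y ≠ x ∧ α y = g := by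
        by_contra hno
        push Not at hno
        have l1 : lowC α b (g + 1) ≤ 1 := by
          by_contra h
          push Not at h
          obtain ⟨u, v, u1, u2, u3, v1, v2, v3, huv⟩ := low_two.1 h
          have a1 := hno u u1 u2
          have a2 := hno v v1 v2
          have a3 := hge u u1 (by omega)
          have a4 := hge v v1 (by omega)
          omega
        have l2 : 0 < lowC τ b (g + 1) := low_pos.2 ⟨b, hb1, le_rfl, by omega⟩
        have := low_up α b (g + 1)
        have := low_up τ b (g + 1)
        omega
      obtain ⟨y, y1, y2, y3, y4⟩ := hy
      have hq1 := hgt (q - 1) (by omega) (by omega)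
      have := hB x y (q - 1) q x1 y1 (by omega) (by omega) (by omega) (by omega) (by omega)
        (by omega) (by omega) hqn (by omega) (by omega) (by omega) (by omega)
      omega
    have hτc : tailC n τ b (g + 1) = q - b := by
      have := tt (g + 1); have := eτ (g + 1); omega
    have hγc : tailC n γ b (g + 1) = q - b := by
      have := tg (g + 1); have := eγ (g + 1); omega
    have fτ := tail_full hqn hbq.le hτc hτz
    have fγ := tail_full hqn hbq.le hγc hγz
    refine ⟨q, hbq.le, hqn, ?_, ?_, ?_, ?_⟩
    · intro i h1 h2
      by_cases h : i = b
      · rw [h]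
      · have := hτge i h1 h2 h; omega
    · intro i h1 h2
      by_contra h
      have : 0 < tailC n τ q (g + 1) := tail_pos.2 ⟨i, h1, h2, by omega⟩
      omega
    · intro c hc1 hc2
      left
      refine le_trans ?_ hlowτ
      refine Finset.card_le_card ?_
      intro i; simp only [Finset.mem_filter]; rintro ⟨u, v⟩; exact ⟨u, by omega⟩
    · have s1 := sum_split hqn hbq.le hτz fτ
      have s2 := sum_split hqn hbq.le hγz fγ
      have s3 := (tot_sum hτ (fun y => if g + 1 ≤ y then y else 0)).symm.trans
        (tot_sum hγ (fun y => if g + 1 ≤ y then y else 0))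
      have s4 : ∑ i ∈ Finset.Icc 1 b, (fun y => if g + 1 ≤ y then y else 0) (τ i) =
          ∑ i ∈ Finset.Icc 1 b, (fun y => if g + 1 ≤ y then y else 0) (γ i) := by
        refine Finset.sum_congr rfl fun i hi => ?_
        rw [Finset.mem_Icc] at hi
        rcases Nat.lt_or_ge i b with h | h
        · rw [heq i hi.1 h]
        · have : i = b := by omega
          subst this
          have h1 : ¬ (g + 1 ≤ τ i) := by omega
          have h2 : ¬ (g + 1 ≤ γ i) := by omega
          simp only [h1, h2, if_false]
      rw [s1, s2, s4] at s3
      exact Nat.add_left_cancel s3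

theorem stmt12 (n : ℕ) (α : ℕ → ℕ) (hpos : ∀ i, 1 ≤ i → i ≤ n → 1 ≤ α i)
    (hav : AvoidsKM n α) (γ τ : ℕ → ℕ)
    (hγ : InLSwap n α γ) (hτ : InLSwap n α τ) (hlex : LexGT n γ τ)
    (T S : ℕ → ℕ → ℕ) (hT : IsQKT n γ T) (hS : IsQKT n τ S) :
    ∃ v, wtOf n γ T v ≠ wtOf n τ S v := by
  by_contra hcon
  push Not at hcon
  obtain ⟨b, hb1, hb, heq, hlt⟩ := hlex
  obtain ⟨k, hbk, hkn, h1, h2, h3, h4⟩ :=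
    shape_key (pa_of hav) (pb_of hav) hγ hτ hb1 hb heq hlt
  have ht : 1 ≤ τ b := by
    by_contra h
    obtain ⟨x, x1, x2, x3⟩ := low_pos.1
      (lt_of_lt_of_le (low_pos.2 ⟨b, hb1, hb, Nat.lt_of_not_le h⟩) (low_le hτ n 1))
    have := hpos x x1 x2
    omega
  have hu := PC_upper hS hkn ht hlt h1 h2 h3
  have hl := PC_lower hT hkn
  have hpc : PC n γ T k = PC n τ S k := by
    rw [PC_eq, PC_eq]; exact Finset.sum_congr rfl fun v _ => hcon v
  have hs : ∀ σ : ℕ → ℕ, ∑ i ∈ Finset.Icc 1 k, σ i =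
      ∑ i ∈ Finset.Icc 1 (b - 1), σ i + σ b + ∑ i ∈ Finset.Ioc b k, σ i := by
    intro σ
    rw [Icc_split hbk, Finset.sum_union (Icc_disj b k)]
    congr 1
    obtain ⟨c, rfl⟩ : ∃ c, b = c + 1 := ⟨b - 1, by omega⟩
    rw [Finset.sum_Icc_succ_top (by omega)]
    simp
  have hpre : ∑ i ∈ Finset.Icc 1 (b - 1), γ i = ∑ i ∈ Finset.Icc 1 (b - 1), τ i := by
    refine Finset.sum_congr rfl fun i hi => ?_
    rw [Finset.mem_Icc] at hi
    exact heq i hi.1 (by omega)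
  have s1 := hs γ
  have s2 := hs τ
  omega
end

section
/- If a weak composition α with all parts ≥ 1 avoids all patterns in KM = {(0,1,2),(0,0,2,2),(0,0,2,1),(1,0,3,2),(1,0,2,2)}, then no two distinct quasi-key tableaux of shape α have the same weight; equivalently, the quasi-key polynomial D_α = Σ_{T ∈ qKT(α)} x^{wt(T)} is multiplicity-free (all monomial coefficients are 0 or 1). -/
open Finset

theorem av012 {n : ℕ} {α : ℕ → ℕ} (hav : AvoidsKM n α) {i j k : ℕ} (h1 : 1 ≤ i) (hij : i < j)
    (hjk : j < k) (hk : k ≤ n) (h12 : α i < α j) (h23 : α j < α k) : False := by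
  refine hav [0,1,2] (by simp) ⟨(![i,j,k] : Fin 3 → ℕ), ?_, ?_, ?_, ?_⟩
  · intro a b hab
    fin_cases a <;> fin_cases b <;> simp at hab ⊢ <;> omega
  · intro a
    fin_cases a <;> simp <;> omega
  · intro a b
    fin_cases a <;> fin_cases b <;> simp <;> omega
  · intro a b
    fin_cases a <;> fin_cases b <;> simp <;> rw [le_abs] <;> omega

theorem av4 {n : ℕ} {α : ℕ → ℕ} (hav : AvoidsKM n α) {i j k l : ℕ} (h1 : 1 ≤ i) (hij : i < j)
    (hjk : j < k) (hkl : k < l) (hk : l ≤ n) (hi : α i < α l) (hj : α j < α l)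
    (hs : α l ≤ α k) (h2 : α i + 2 ≤ α l ∨ α j + 2 ≤ α l) : False := by
  rcases lt_trichotomy (α i) (α j) with h | h | h
  · exact av012 hav h1 hij hjk (by omega) h (by omega)
  · rcases Nat.lt_or_ge (α l) (α k) with h' | h'
    · refine hav [0,0,2,1] (by simp) ⟨(![i,j,k,l] : Fin 4 → ℕ), ?_, ?_, ?_, ?_⟩
      · intro a b hab
        fin_cases a <;> fin_cases b <;> simp at hab ⊢ <;> omega
      · intro a
        fin_cases a <;> simp <;> omega
      · intro a b
        fin_cases a <;> fin_cases b <;> simp <;> omega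
      · intro a b
        fin_cases a <;> fin_cases b <;> simp <;> rw [le_abs] <;> omega
    · refine hav [0,0,2,2] (by simp) ⟨(![i,j,k,l] : Fin 4 → ℕ), ?_, ?_, ?_, ?_⟩
      · intro a b hab
        fin_cases a <;> fin_cases b <;> simp at hab ⊢ <;> omega
      · intro a
        fin_cases a <;> simp <;> omega
      · intro a b
        fin_cases a <;> fin_cases b <;> simp <;> omega
      · intro a b
        fin_cases a <;> fin_cases b <;> simp <;> rw [le_abs] <;> omega
  · rcases Nat.lt_or_ge (α l) (α k) with h' | h'
    · refine hav [1,0,3,2] (by simp) ⟨(![i,j,k,l] : Fin 4 → ℕ), ?_, ?_, ?_, ?_⟩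
      · intro a b hab
        fin_cases a <;> fin_cases b <;> simp at hab ⊢ <;> omega
      · intro a
        fin_cases a <;> simp <;> omega
      · intro a b
        fin_cases a <;> fin_cases b <;> simp <;> omega
      · intro a b
        fin_cases a <;> fin_cases b <;> simp <;> rw [le_abs] <;> omega
    · refine hav [1,0,2,2] (by simp) ⟨(![i,j,k,l] : Fin 4 → ℕ), ?_, ?_, ?_, ?_⟩
      · intro a b hab
        fin_cases a <;> fin_cases b <;> simp at hab ⊢ <;> omega
      · intro a
        fin_cases a <;> simp <;> omega
      · intro a b
        fin_cases a <;> fin_cases b <;> simp <;> omega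
      · intro a b
        fin_cases a <;> fin_cases b <;> simp <;> rw [le_abs] <;> omega

theorem avoids_transfer {n s : ℕ} {α α' : ℕ → ℕ} (hs : s ≤ n) (hav : AvoidsKM n α)
    (hle : ∀ i j, 1 ≤ i → i ≤ s → 1 ≤ j → j ≤ s → (α' i ≤ α' j ↔ α i ≤ α j))
    (hd : ∀ i j, 1 ≤ i → i ≤ s → 1 ≤ j → j ≤ s →
      |(α' i : ℤ) - (α' j : ℤ)| ≤ |(α i : ℤ) - (α j : ℤ)|) : AvoidsKM s α' := by
  intro β hβ ⟨j, hj, hb, h1, h2⟩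
  refine hav β hβ ⟨j, hj, fun t => ⟨(hb t).1, (hb t).2.trans hs⟩, fun p q => ?_, fun p q => ?_⟩
  · rw [← hle _ _ (hb p).1 (hb p).2 (hb q).1 (hb q).2]; exact h1 p q
  · exact (h2 p q).trans (hd _ _ (hb p).1 (hb p).2 (hb q).1 (hb q).2)

/-- an injective self-map of `[1,s]` is onto -/
theorem image_full {s : ℕ} {f : ℕ → ℕ} (hm : ∀ r, 1 ≤ r → r ≤ s → 1 ≤ f r ∧ f r ≤ s)
    (hi : ∀ r r', 1 ≤ r → r < r' → r' ≤ s → f r ≠ f r') :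
    Set.InjOn f (Icc 1 s : Finset ℕ) ∧ (Icc 1 s).image f = Icc 1 s := by
  have hinj : Set.InjOn f (Icc 1 s : Finset ℕ) := by
    intro x hx y hy hxy
    simp at hx hy
    rcases lt_trichotomy x y with h | h | h
    · exact absurd hxy (hi x y hx.1 h hy.2)
    · exact h
    · exact absurd hxy.symm (hi y x hy.1 h hx.2)
  refine ⟨hinj, Finset.eq_of_subset_of_card_le ?_ ?_⟩
  · intro x hx
    obtain ⟨r, hr, rfl⟩ := Finset.mem_image.1 hx
    simp at hr ⊢
    exact hm r hr.1 hr.2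
  · rw [Finset.card_image_of_injOn hinj]

theorem surj_full {s : ℕ} {f : ℕ → ℕ} (hm : ∀ r, 1 ≤ r → r ≤ s → 1 ≤ f r ∧ f r ≤ s)
    (hi : ∀ r r', 1 ≤ r → r < r' → r' ≤ s → f r ≠ f r') {v : ℕ} (h1 : 1 ≤ v) (h2 : v ≤ s) :
    ∃ r, 1 ≤ r ∧ r ≤ s ∧ f r = v := by
  have h : v ∈ (Icc 1 s).image f := by
    rw [(image_full hm hi).2]; simp; omega
  obtain ⟨r, hr, rfl⟩ := Finset.mem_image.1 h
  simp at hr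
  exact ⟨r, hr.1, hr.2, rfl⟩

theorem sum_full {s : ℕ} {f : ℕ → ℕ} (hm : ∀ r, 1 ≤ r → r ≤ s → 1 ≤ f r ∧ f r ≤ s)
    (hi : ∀ r r', 1 ≤ r → r < r' → r' ≤ s → f r ≠ f r') (φ : ℕ → ℕ) :
    ∑ r ∈ Icc 1 s, φ (f r) = ∑ r ∈ Icc 1 s, φ r := by
  obtain ⟨h1, h2⟩ := image_full hm hi
  conv_rhs => rw [← h2]
  rw [Finset.sum_image h1]

theorem eq_full {s : ℕ} {f g : ℕ → ℕ} (hm : ∀ r, 1 ≤ r → r ≤ s → 1 ≤ f r ∧ f r ≤ s)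
    (hi : ∀ r r', 1 ≤ r → r < r' → r' ≤ s → f r ≠ f r')
    (hm' : ∀ r, 1 ≤ r → r ≤ s → 1 ≤ g r ∧ g r ≤ s)
    (hi' : ∀ r r', 1 ≤ r → r < r' → r' ≤ s → g r ≠ g r')
    (hle : ∀ r, 1 ≤ r → r ≤ s → f r ≤ g r) : ∀ r, 1 ≤ r → r ≤ s → f r = g r := by
  have h := (sum_full hm hi id).trans (sum_full hm' hi' id).symm
  simp only [id] at h
  have := (Finset.sum_eq_sum_iff_of_le (s := Icc 1 s) (f := f) (g := g)
    (fun r hr => by simp at hr; exact hle r hr.1 hr.2)).1 h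
  intro r h1 h2
  exact this r (by simp; omega)

/-- `T(r,c+1) ≠ T(x,c)` when row `x` ends in column `c` and row `r` is longer. -/
theorem end_ne {n : ℕ} {α : ℕ → ℕ} {T : ℕ → ℕ → ℕ} (hT : IsQKT n α T) {r x c : ℕ}
    (hx : α x = c) (hr : c < α r) (hx1 : 1 ≤ x) (hxn : x ≤ n) (hr1 : 1 ≤ r) (hrn : r ≤ n)
    (hc : 1 ≤ c) : T r (c+1) ≠ T x c := by
  have d1 : InD n α r (c+1) := ⟨hr1, hrn, by omega, by omega⟩
  have d2 : InD n α r c := ⟨hr1, hrn, by omega, by omega⟩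
  have d3 : InD n α x c := ⟨hx1, hxn, by omega, by omega⟩
  rcases lt_trichotomy x r with h | h | h
  · have := hT.qkt4 x r c h (by omega) d3 d1; omega
  · subst h; omega
  · have hne := hT.colDistinct r x c d2 d3 (by omega)
    rcases Nat.lt_or_ge (T x c) (T r c) with h' | h'
    · have := (hT.qkt3 r x c d2 d3 h h').2; omega
    · have := hT.rowDec r c (c+1) d2 d1 (by omega); omega

theorem fmin_ne {n : ℕ} {α : ℕ → ℕ} {T : ℕ → ℕ → ℕ} (hT : IsQKT n α T) {r x c : ℕ}
    (hpos : ∀ i, 1 ≤ i → i ≤ n → 1 ≤ α i) (hc : 1 ≤ c)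
    (hx : c ≤ α x + 1) (hr : c ≤ α r + 1) (hx1 : 1 ≤ x) (hxn : x ≤ n) (hr1 : 1 ≤ r) (hrn : r ≤ n)
    (hne : r ≠ x) : T r (min c (α r)) ≠ T x (min c (α x)) := by
  have p1 := hpos x hx1 hxn
  have p2 := hpos r hr1 hrn
  rcases Nat.lt_or_ge (α x) c with h | h <;> rcases Nat.lt_or_ge (α r) c with h' | h'
  · rw [min_eq_right h.le, min_eq_right h'.le]
    have : α r = α x := by omega
    rw [this]
    exact hT.colDistinct r x _ ⟨hr1, hrn, by omega, by omega⟩ ⟨hx1, hxn, by omega, by omega⟩ hne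
  · rw [min_eq_right h.le, min_eq_left h']
    have e : c = α x + 1 := by omega
    rw [e]
    exact end_ne hT rfl (by omega) hx1 hxn hr1 hrn p1
  · rw [min_eq_right h'.le, min_eq_left h]
    have e : c = α r + 1 := by omega
    rw [e]
    exact (end_ne hT rfl (by omega) hr1 hrn hx1 hxn p2).symm
  · rw [min_eq_left h, min_eq_left h']
    exact hT.colDistinct r x _ ⟨hr1, hrn, by omega, by omega⟩ ⟨hx1, hxn, by omega, by omega⟩ hne

theorem fullplus {n : ℕ} {α : ℕ → ℕ} {T : ℕ → ℕ → ℕ} (hT : IsQKT n α T)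
    (hpos : ∀ i, 1 ≤ i → i ≤ n → 1 ≤ α i) {k m c : ℕ} (hkm : k < m) (hmn : m ≤ n)
    (hc : 1 ≤ c) (hcm : c ≤ α m) (hk : ∀ r, 1 ≤ r → r ≤ k → c ≤ α r + 1) : k < T m c := by
  by_contra hcon
  have hp := hT.pos m c ⟨by omega, hmn, hc, hcm⟩
  obtain ⟨r, h1, h2, h3⟩ := surj_full (s := k) (f := fun r => T r (min c (α r)))
    (fun r h1 h2 => by
      have p := hpos r h1 (by omega)
      have d : InD n α r (min c (α r)) := ⟨h1, by omega, by omega, by omega⟩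
      have := hT.pos _ _ d
      have := hT.rowBound _ _ d
      omega)
    (fun r r' h1 h2 h3 => fmin_ne hT hpos hc (hk r' (by omega) h3) (hk r h1 (by omega))
      (by omega) (by omega) h1 (by omega) (by omega)) hp (by omega)
  have := fmin_ne hT hpos hc (x := m) (r := r) (by omega) (hk r h1 h2) (by omega) hmn h1
    (by omega) (by omega)
  rw [min_eq_left hcm] at this
  exact this h3

theorem nonhigh {n : ℕ} {α : ℕ → ℕ} {T : ℕ → ℕ → ℕ} (hT : IsQKT n α T)
    (hpos : ∀ i, 1 ≤ i → i ≤ n → 1 ≤ α i) {m c : ℕ} (d : InD n α m c)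
    (hk : ∀ r, 1 ≤ r → r < m → c ≤ α r) : T m c = m := by
  have h0 := d.1
  have := fullplus hT hpos (k := m - 1) (m := m) (c := c) (by omega) d.2.1 d.2.2.1 d.2.2.2
    (fun r h1 h2 => by have := hk r h1 (by omega); omega)
  have := hT.rowBound _ _ d
  omega

def rowCnt (α : ℕ → ℕ) (T : ℕ → ℕ → ℕ) (i v : ℕ) : ℕ :=
  ((Icc 1 (α i)).filter (fun j => T i j = v)).card

theorem wt_eq_sum (n : ℕ) (α : ℕ → ℕ) (T : ℕ → ℕ → ℕ) (v : ℕ) :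
    wtOf n α T v = ∑ i ∈ Icc 1 n, rowCnt α T i v := by
  unfold wtOf Boxes rowCnt
  rw [Finset.filter_biUnion, Finset.card_biUnion]
  · refine Finset.sum_congr rfl fun i _ => ?_
    rw [Finset.filter_image, Finset.card_image_of_injective]
    intro a b h
    simpa using h
  · intro i _ j _ hij
    rw [Function.onFun, Finset.disjoint_left]
    rintro ⟨x, y⟩ h1 h2
    simp at h1 h2
    omega

theorem rowCnt_congr {α : ℕ → ℕ} {T S : ℕ → ℕ → ℕ} {i : ℕ}
    (h : ∀ j, 1 ≤ j → j ≤ α i → T i j = S i j) (v : ℕ) : rowCnt α T i v = rowCnt α S i v := by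
  unfold rowCnt
  congr 1
  refine Finset.filter_congr fun j hj => ?_
  simp at hj
  rw [h j hj.1 hj.2]

theorem rowCnt_zero {α : ℕ → ℕ} {T : ℕ → ℕ → ℕ} {i v : ℕ}
    (h : ∀ j, 1 ≤ j → j ≤ α i → T i j ≠ v) : rowCnt α T i v = 0 := by
  unfold rowCnt
  rw [Finset.card_eq_zero, Finset.filter_eq_empty_iff]
  intro j hj
  simp at hj
  exact h j hj.1 hj.2

/-- number of entries ≥ w -/
theorem cnt_ge {L n w : ℕ} {f : ℕ → ℕ} (hb : ∀ j, 1 ≤ j → j ≤ L → f j ≤ n) :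
    ((Icc 1 L).filter (fun j => w ≤ f j)).card
      = ∑ v ∈ Icc w n, ((Icc 1 L).filter (fun j => f j = v)).card := by
  rw [Finset.card_eq_sum_card_fiberwise (f := f) (t := Icc w n)]
  · refine Finset.sum_congr rfl fun v hv => ?_
    congr 1
    ext j
    simp at hv ⊢
    intro h1 h2
    omega
  · intro j hj
    simp at hj ⊢
    exact ⟨hj.2, hb j hj.1.1 hj.1.2⟩

theorem ge_iff {L w : ℕ} {f : ℕ → ℕ} (ha : ∀ j j', 1 ≤ j → j ≤ j' → j' ≤ L → f j' ≤ f j)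
    {c : ℕ} (h1 : 1 ≤ c) (h2 : c ≤ L) :
    w ≤ f c ↔ c ≤ ((Icc 1 L).filter (fun j => w ≤ f j)).card := by
  constructor
  · intro h
    have : Icc 1 c ⊆ (Icc 1 L).filter (fun j => w ≤ f j) := by
      intro j hj
      simp at hj ⊢
      have := ha j c hj.1 hj.2 h2
      omega
    simpa using Finset.card_le_card this
  · intro h
    by_contra hcon
    have : (Icc 1 L).filter (fun j => w ≤ f j) ⊆ Icc 1 (c-1) := by
      intro j hj
      simp at hj ⊢
      refine ⟨hj.1.1, ?_⟩
      by_contra h'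
      have := ha c j h1 (by omega) hj.1.2
      omega
    have := Finset.card_le_card this
    simp at this
    omega

theorem row_agree {L n s : ℕ} {f g : ℕ → ℕ}
    (ha : ∀ j j', 1 ≤ j → j ≤ j' → j' ≤ L → f j' ≤ f j)
    (ha' : ∀ j j', 1 ≤ j → j ≤ j' → j' ≤ L → g j' ≤ g j)
    (hb : ∀ j, 1 ≤ j → j ≤ L → f j ≤ n) (hb' : ∀ j, 1 ≤ j → j ≤ L → g j ≤ n)
    (hc : ∀ v, s < v → ((Icc 1 L).filter (fun j => f j = v)).card
      = ((Icc 1 L).filter (fun j => g j = v)).card)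
    {c : ℕ} (h1 : 1 ≤ c) (h2 : c ≤ L) {w : ℕ} (hw : s < w) : w ≤ f c ↔ w ≤ g c := by
  rw [ge_iff ha h1 h2, ge_iff ha' h1 h2, cnt_ge hb, cnt_ge hb']
  rw [Finset.sum_congr rfl]
  intro v hv
  simp at hv
  exact hc v (by omega)

theorem exists_last (P : ℕ → Prop) (m : ℕ) :
    ∃ s ≤ m, (s = 0 ∨ P s) ∧ ∀ r, s < r → r ≤ m → ¬ P r := by
  induction m with
  | zero => exact ⟨0, le_rfl, Or.inl rfl, fun r h1 h2 => by omega⟩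
  | succ m ih =>
    by_cases h : P (m+1)
    · exact ⟨m+1, le_rfl, Or.inr h, fun r h1 h2 => by omega⟩
    · obtain ⟨s, h1, h2, h3⟩ := ih
      refine ⟨s, by omega, h2, fun r h4 h5 => ?_⟩
      rcases Nat.lt_or_ge r (m+1) with h6 | h6
      · exact h3 r h4 (by omega)
      · have : r = m+1 := by omega
        rw [this]; exact h

theorem restrict {n m : ℕ} {α : ℕ → ℕ} {T : ℕ → ℕ → ℕ} (hm : m ≤ n) (hT : IsQKT n α T) :
    IsQKT m α T := by
  have u : ∀ i j, InD m α i j → InD n α i j := fun i j h => ⟨h.1, h.2.1.trans hm, h.2.2⟩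
  constructor
  · exact fun i j h => hT.pos i j (u _ _ h)
  · exact fun i j j' h h' => hT.rowDec i j j' (u _ _ h) (u _ _ h')
  · exact fun i j h => hT.rowBound i j (u _ _ h)
  · exact fun i i' j h h' => hT.colDistinct i i' j (u _ _ h) (u _ _ h')
  · exact fun i i' h h' => hT.firstColInc i i' (u _ _ h) (u _ _ h')
  · intro r r' c h h' h1 h2
    have := hT.qkt3 r r' c (u _ _ h) (u _ _ h') h1 h2
    exact ⟨⟨h.1, h.2.1, this.1.2.2⟩, this.2⟩
  · exact fun r s c h1 h2 h h' => hT.qkt4 r s c h1 h2 (u _ _ h) (u _ _ h')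

/-- The situation of the main case. -/
structure Sit (n : ℕ) (α : ℕ → ℕ) (T : ℕ → ℕ → ℕ) (s a N : ℕ) : Prop where
  hT : IsQKT n α T
  hpos : ∀ i, 1 ≤ i → i ≤ n → 1 ≤ α i
  ha1 : 1 ≤ a
  has : a < s
  hsn : s < n
  haN : α a < N
  hNn : N < α n
  hlen : ∀ r, 1 ≤ r → r ≤ s → r ≠ a → α n ≤ α r
  big : ∀ c, 1 ≤ c → c ≤ N → s < T n c
  small : ∀ c, N < c → c ≤ α n → T n c ≤ s
  mid : ∀ r c, s < r → r < n → 1 ≤ c → c ≤ α r → T r c = r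

namespace Sit

variable {n : ℕ} {α : ℕ → ℕ} {T : ℕ → ℕ → ℕ} {s a N : ℕ}

theorem gmaps (h : Sit n α T s a N) {c : ℕ} (h1 : N < c) (h2 : c ≤ α n) :
    ∀ r, 1 ≤ r → r ≤ s → 1 ≤ (if r = a then T n c else T r c) ∧
      (if r = a then T n c else T r c) ≤ s := by
  intro r hr hr'
  have := h.hsn
  split_ifs with e
  · exact ⟨h.hT.pos n c ⟨by omega, le_rfl, by omega, h2⟩, h.small c h1 h2⟩
  · have := h.hlen r hr hr' e
    have d : InD n α r c := ⟨hr, by omega, by omega, by omega⟩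
    exact ⟨h.hT.pos _ _ d, (h.hT.rowBound _ _ d).trans hr'⟩

theorem ginj (h : Sit n α T s a N) {c : ℕ} (h1 : N < c) (h2 : c ≤ α n) :
    ∀ r r', 1 ≤ r → r < r' → r' ≤ s → (if r = a then T n c else T r c) ≠
      (if r' = a then T n c else T r' c) := by
  intro r r' hr hrr hr'
  have := h.hsn
  have dn : InD n α n c := ⟨by omega, le_rfl, by omega, h2⟩
  have key : ∀ x, 1 ≤ x → x ≤ s → x ≠ a → InD n α x c := fun x hx hx' e => by
    have := h.hlen x hx hx' e
    exact ⟨hx, by omega, by omega, by omega⟩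
  split_ifs with e e' e'
  · omega
  · exact h.hT.colDistinct _ _ _ dn (key _ (by omega) hr' e') (by omega)
  · exact h.hT.colDistinct _ _ _ (key _ hr (by omega) e) dn (by omega)
  · exact h.hT.colDistinct _ _ _ (key _ hr (by omega) e) (key _ (by omega) hr' e') (by omega)

theorem gconst (h : Sit n α T s a N) {c : ℕ} (h1 : N < c) (h2 : c ≤ α n) :
    ∀ r, 1 ≤ r → r ≤ s → (if r = a then T n (α n) else T r (α n)) =
      (if r = a then T n c else T r c) := by
  have hN := h.hNn
  have := h.hsn
  refine eq_full (h.gmaps hN le_rfl) (h.ginj hN le_rfl) (h.gmaps h1 h2) (h.ginj h1 h2) ?_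
  intro r hr hr'
  split_ifs with e
  · exact h.hT.rowDec _ _ _ ⟨by omega, le_rfl, by omega, h2⟩
      ⟨by omega, le_rfl, by omega, le_rfl⟩ h2
  · have := h.hlen r hr hr' e
    exact h.hT.rowDec _ _ _ ⟨hr, by omega, by omega, by omega⟩
      ⟨hr, by omega, by omega, by omega⟩ h2

theorem nconst (h : Sit n α T s a N) {c : ℕ} (h1 : N < c) (h2 : c ≤ α n) :
    T n c = T n (α n) := by
  have := h.gconst h1 h2 a h.ha1 h.has.le
  simpa using this.symm

theorem rconst (h : Sit n α T s a N) {r c : ℕ} (hr : 1 ≤ r) (hr' : r ≤ s) (hra : r ≠ a)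
    (h1 : N < c) (h2 : c ≤ α n) : T r c = T r (α n) := by
  have := h.gconst h1 h2 r hr hr'
  simpa [hra] using this.symm

/-- next column after `α n` coincides with column `α n` -/
theorem rnext (h : Sit n α T s a N) {r : ℕ} (hr : 1 ≤ r) (hr' : r ≤ s) (hra : r ≠ a)
    (hl : α n < α r) : T r (α n + 1) = T r (α n) := by
  have hN := h.hNn
  have hsn := h.hsn
  have dn : InD n α n (α n) := ⟨by omega, le_rfl, by omega, le_rfl⟩
  have hmne : ∀ x, 1 ≤ x → x ≤ s → x ≠ a → T x (min (α n + 1) (α x)) ≠ T n (α n) := by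
    intro x hx hx' e
    have hxl := h.hlen x hx hx' e
    have d : InD n α x (α n) := ⟨hx, by omega, by omega, by omega⟩
    have hne := h.hT.colDistinct _ _ _ d dn (by omega)
    rcases Nat.lt_or_ge (α n) (α x) with hl | hl
    · rw [min_eq_left (by omega)]
      rcases Nat.lt_or_ge (T n (α n)) (T x (α n)) with h' | h'
      · have := (h.hT.qkt3 x n _ d dn (by omega) h').2
        omega
      · have := h.hT.rowDec x (α n) (α n + 1) d ⟨hx, by omega, by omega, by omega⟩ (by omega)
        omega
    · have : α x = α n := by omega
      rw [this, min_eq_right (by omega)]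
      exact hne
  have key := eq_full (s := s)
    (f := fun x => if x = a then T n (α n) else T x (min (α n + 1) (α x)))
    (g := fun x => if x = a then T n (α n) else T x (α n)) ?_ ?_
    (h.gmaps hN le_rfl) (h.ginj hN le_rfl) ?_ r hr hr'
  · simp only [hra, if_false] at key
    rwa [min_eq_left (by omega)] at key
  · intro x hx hx'
    split_ifs with e
    · exact ⟨h.hT.pos _ _ dn, h.small _ hN le_rfl⟩
    · have := h.hlen x hx hx' e
      have d : InD n α x (min (α n + 1) (α x)) := ⟨hx, by omega, by omega, by omega⟩
      exact ⟨h.hT.pos _ _ d, (h.hT.rowBound _ _ d).trans hx'⟩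
  · intro x y hx hxy hy
    split_ifs with e e' e'
    · omega
    · exact (hmne y (by omega) hy e').symm
    · exact hmne x hx (by omega) e
    · have := h.hlen x hx (by omega) e
      have := h.hlen y (by omega) hy e'
      exact fmin_ne h.hT h.hpos (by omega) (by omega) (by omega) (by omega) (by omega)
        (by omega) (by omega) (by omega)
  · intro x hx hx'
    split_ifs with e
    · exact le_rfl
    · have := h.hlen x hx hx' e
      exact h.hT.rowDec _ _ _ ⟨hx, by omega, by omega, by omega⟩
        ⟨hx, by omega, by omega, by omega⟩ (by omega)

theorem last_eq_s (h : Sit n α T s a N) (hl : α s = α n) : T n (α n) = s := by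
  have hN := h.hNn
  have hsn := h.hsn
  have has := h.has
  obtain ⟨r, h1, h2, h3⟩ := surj_full (h.gmaps hN le_rfl) (h.ginj hN le_rfl) (v := s)
    (by omega) le_rfl
  have dn : InD n α n (α n) := ⟨by omega, le_rfl, by omega, le_rfl⟩
  split_ifs at h3 with e
  · exact h3
  · have := h.hlen r h1 h2 e
    have d : InD n α r (α n) := ⟨h1, by omega, by omega, by omega⟩
    have := h.hT.rowBound _ _ d
    have hrs : r = s := by omega
    subst hrs
    have := h.hT.colDistinct _ _ _ d dn (by omega)
    have h4 := h.small _ hN le_rfl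
    have := (h.hT.qkt3 r n _ d dn (by omega) (by omega)).1.2.2.2
    omega

end Sit

/-- contracted shape -/
def shp (α : ℕ → ℕ) (n a N : ℕ) (r : ℕ) : ℕ := if r = a then α a else α r - (α n - N)

/-- contracted filling -/
def ctr (α : ℕ → ℕ) (T : ℕ → ℕ → ℕ) (n N : ℕ) (r c : ℕ) : ℕ :=
  if c ≤ N then T r c else T r (c + (α n - N))

namespace Sit

variable {n : ℕ} {α : ℕ → ℕ} {T : ℕ → ℕ → ℕ} {s a N : ℕ}

/-- column map -/
theorem ind1 (h : Sit n α T s a N) {r c : ℕ} (d : InD s (shp α n a N) r c) :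
    InD n α r (if c ≤ N then c else c + (α n - N)) ∧ InD n α r c ∧ (N < c → r ≠ a) := by
  obtain ⟨d1, d2, d3, d4⟩ := d
  have := h.hsn
  have := h.hNn
  have := h.haN
  unfold shp at d4
  split_ifs at d4 with e
  · subst e
    rw [if_pos (by omega)]
    refine ⟨⟨d1, by omega, d3, d4⟩, ⟨d1, by omega, d3, d4⟩, by omega⟩
  · have := h.hlen r d1 d2 e
    refine ⟨?_, ⟨d1, by omega, d3, by omega⟩, fun _ => e⟩
    split_ifs
    · exact ⟨d1, by omega, d3, by omega⟩
    · exact ⟨d1, by omega, by omega, by omega⟩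

theorem ctr_eq (T : ℕ → ℕ → ℕ) (r c : ℕ) :
    ctr α T n N r c = T r (if c ≤ N then c else c + (α n - N)) := by
  unfold ctr; split_ifs <;> rfl

/-- value in the column after the cut -/
theorem ctr_next (h : Sit n α T s a N) {r : ℕ} (d : InD s (shp α n a N) r (N+1)) :
    ctr α T n N r (N+1) = T r (N+1) ∧ α n < α r := by
  have hN := h.hNn
  have hra := (h.ind1 d).2.2 (by omega)
  have hl := (h.ind1 d).1
  rw [if_neg (by omega)] at hl
  have e : N + 1 + (α n - N) = α n + 1 := by omega
  rw [ctr_eq, if_neg (by omega), e, h.rnext d.1 d.2.1 hra (by have := hl.2.2.2; omega),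
    h.rconst (c := N+1) d.1 d.2.1 hra (by omega) (by omega)]
  have := hl.2.2.2
  exact ⟨rfl, by omega⟩

theorem shp_lt (h : Sit n α T s a N) {i j : ℕ} (hi : 1 ≤ i) (hi' : i ≤ s) (hj : 1 ≤ j)
    (hj' : j ≤ s) : shp α n a N i ≤ shp α n a N j ↔ α i ≤ α j := by
  have := h.hNn
  have := h.haN
  have h1 := h.hlen i hi hi'
  have h2 := h.hlen j hj hj'
  unfold shp
  split_ifs with e e' e'
  · subst e; subst e'; simp
  · subst e; have := h2 e'; omega
  · subst e'; have := h1 e; omega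
  · have := h2 e'; have := h1 e; omega

theorem ctr_qkt (h : Sit n α T s a N) : IsQKT s (shp α n a N) (ctr α T n N) := by
  have hN := h.hNn
  have hsn := h.hsn
  have haN := h.haN
  constructor
  · intro i j d
    rw [ctr_eq]; exact h.hT.pos _ _ (h.ind1 d).1
  · intro i j j' d d' hj
    rw [ctr_eq, ctr_eq]
    exact h.hT.rowDec _ _ _ (h.ind1 d).1 (h.ind1 d').1 (by split_ifs <;> omega)
  · intro i j d
    rw [ctr_eq]; exact h.hT.rowBound _ _ (h.ind1 d).1
  · intro i i' j d d' hi
    rw [ctr_eq, ctr_eq]; exact h.hT.colDistinct _ _ _ (h.ind1 d).1 (h.ind1 d').1 hi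
  · intro i i' d d' hi
    rw [ctr_eq, ctr_eq, if_pos (by omega)]
    exact h.hT.firstColInc _ _ (h.ind1 d).2.1 (h.ind1 d').2.1 hi
  · intro r r' c d d' hr hlt
    rw [ctr_eq, ctr_eq] at hlt
    have q := h.hT.qkt3 _ _ _ (h.ind1 d).1 (h.ind1 d').1 hr hlt
    have hra : N < c + 1 → r ≠ a := by
      intro hc e
      have := d.2.2.2
      subst e
      simp [shp] at this
      omega
    have hra' : N < c + 1 → r' ≠ a := by
      intro hc e
      have := d'.2.2.2
      subst e
      simp [shp] at this
      omega
    rcases lt_trichotomy c N with hc | hc | hc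
    · rw [if_pos (by omega)] at q
      have dd : InD s (shp α n a N) r (c+1) := by
        refine ⟨d.1, d.2.1, by omega, ?_⟩
        have := q.1.2.2.2
        unfold shp
        split_ifs with e
        · subst e; exact this
        · have := h.hlen r d.1 d.2.1 e
          omega
      refine ⟨dd, ?_⟩
      rw [ctr_eq, ctr_eq, if_pos (by omega), if_pos (by omega)]
      exact q.2
    · subst hc
      rw [if_pos le_rfl] at q hlt
      have e1 := hra (by omega)
      have e2 := hra' (by omega)
      have l1 := h.hlen r d.1 d.2.1 e1
      have l2 := h.hlen r' d'.1 d'.2.1 e2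
      have dr : InD n α r (α n) := ⟨d.1, by have := d.2.1; omega, by omega, l1⟩
      have dr' : InD n α r' (α n) := ⟨d'.1, by have := d'.2.1; omega, by omega, l2⟩
      have c1 := h.rconst (c := c+1) d.1 d.2.1 e1 (by omega) (by omega)
      have i1 := h.hT.rowDec r' c (α n) (h.ind1 d').2.1 dr' (by omega)
      have q2 := (h.hT.qkt3 r r' (α n) dr dr' hr (by omega)).1.2.2.2
      have dd : InD s (shp α n a c) r (c+1) := by
        refine ⟨d.1, d.2.1, by omega, ?_⟩
        unfold shp
        rw [if_neg e1]; omega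
      refine ⟨dd, ?_⟩
      rw [(h.ctr_next dd).1, ctr_eq, if_pos le_rfl]
      exact q.2
    · rw [if_neg (by omega)] at q
      have e1 := hra (by omega)
      have dd : InD s (shp α n a N) r (c+1) := by
        refine ⟨d.1, d.2.1, by omega, ?_⟩
        have := q.1.2.2.2
        unfold shp
        rw [if_neg e1]; omega
      refine ⟨dd, ?_⟩
      rw [ctr_eq, ctr_eq, if_neg (by omega), if_neg (by omega)]
      have e : c + 1 + (α n - N) = c + (α n - N) + 1 := by omega
      rw [e]
      exact q.2
  · intro r r' c hr hlt d d'
    have hlt' : α r < α r' := by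
      have := h.shp_lt d'.1 d'.2.1 d.1 d.2.1
      omega
    have dd := (h.ind1 d).1
    have dd' := (h.ind1 d').1
    rcases lt_trichotomy c N with hc | hc | hc
    · rw [if_pos (by omega)] at dd dd'
      rw [ctr_eq, ctr_eq, if_pos (by omega), if_pos (by omega)]
      exact h.hT.qkt4 _ _ _ hr hlt' dd dd'
    · subst hc
      rw [(h.ctr_next d').1, ctr_eq, if_pos le_rfl]
      exact h.hT.qkt4 _ _ _ hr hlt' (h.ind1 d).2.1 (h.ind1 d').2.1
    · rw [if_neg (by omega)] at dd dd'
      have e : c + 1 + (α n - N) = c + (α n - N) + 1 := by omega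
      rw [e] at dd'
      rw [ctr_eq, ctr_eq, if_neg (by omega), if_neg (by omega), e]
      exact h.hT.qkt4 _ _ _ hr hlt' dd dd'

theorem cnt_row (h : Sit n α T s a N) {r : ℕ} (h1 : 1 ≤ r) (h2 : r ≤ s) (hra : r ≠ a) (v : ℕ) :
    rowCnt α T r v = rowCnt (shp α n a N) (ctr α T n N) r v
      + (α n - N) * (if T r (α n) = v then 1 else 0) := by
  have hN := h.hNn
  have hl := h.hlen r h1 h2 hra
  have e1 : ∀ (L : ℕ) (f : ℕ → ℕ), ((Icc 1 L).filter (fun j => f j = v)).card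
      = ∑ j ∈ Ico 1 (L+1), if f j = v then 1 else 0 := by
    intro L f
    rw [Finset.card_filter]
    rfl
  unfold rowCnt
  rw [e1, e1]
  have es : shp α n a N r = α r - (α n - N) := by simp [shp, hra]
  rw [es]
  rw [← Finset.sum_Ico_consecutive _ (show 1 ≤ N + 1 by omega) (show N + 1 ≤ α r + 1 by omega),
    ← Finset.sum_Ico_consecutive _ (show N+1 ≤ α n + 1 by omega) (show α n + 1 ≤ α r + 1 by omega),
    ← Finset.sum_Ico_consecutive _ (show 1 ≤ N + 1 by omega)
      (show N + 1 ≤ α r - (α n - N) + 1 by omega)]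
  have a1 : ∑ j ∈ Ico 1 (N+1), (if T r j = v then 1 else 0)
      = ∑ j ∈ Ico 1 (N+1), (if ctr α T n N r j = v then 1 else 0) := by
    refine Finset.sum_congr rfl fun j hj => ?_
    simp at hj
    rw [ctr_eq, if_pos (show j ≤ N by omega)]
  have a2 : ∑ j ∈ Ico (N+1) (α n + 1), (if T r j = v then 1 else 0)
      = (α n - N) * (if T r (α n) = v then 1 else 0) := by
    rw [Finset.sum_congr rfl (g := fun _ => if T r (α n) = v then 1 else 0)]
    · simp
    · intro j hj
      simp at hj
      rw [h.rconst h1 h2 hra (by omega) (by omega)]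
  have a3 : ∑ j ∈ Ico (α n+1) (α r + 1), (if T r j = v then 1 else 0)
      = ∑ j ∈ Ico (N+1) (α r - (α n - N) +1), (if ctr α T n N r j = v then 1 else 0) := by
    have := Finset.sum_Ico_add' (fun j => if T r j = v then 1 else 0) (N+1)
      (α r - (α n - N) +1) (α n - N)
    rw [show N + 1 + (α n - N) = α n + 1 by omega,
      show α r - (α n - N) +1 + (α n - N) = α r + 1 by omega] at this
    rw [← this]
    refine Finset.sum_congr rfl fun j hj => ?_
    simp at hj
    rw [ctr_eq, if_neg (show ¬ j ≤ N by omega)]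
  rw [a1, a2, a3]
  ring

theorem cnt_last (h : Sit n α T s a N) {v : ℕ} (hv : v ≤ s) :
    rowCnt α T n v = (α n - N) * (if T n (α n) = v then 1 else 0) := by
  have hN := h.hNn
  unfold rowCnt
  rw [Finset.card_filter]
  change ∑ j ∈ Ico 1 (α n+1), _ = _
  rw [← Finset.sum_Ico_consecutive _ (show 1 ≤ N + 1 by omega) (show N + 1 ≤ α n + 1 by omega)]
  rw [Finset.sum_eq_zero, Finset.sum_congr rfl (g := fun _ => if T n (α n) = v then 1 else 0)]
  · simp
  · intro j hj
    simp at hj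
    rw [h.nconst (by omega) (by omega)]
  · intro j hj
    simp at hj
    have := h.big j (by omega) (by omega)
    rw [if_neg (by omega)]

theorem wt_ctr (h : Sit n α T s a N) {v : ℕ} (hv1 : 1 ≤ v) (hv : v ≤ s) :
    wtOf n α T v = wtOf s (shp α n a N) (ctr α T n N) v + (α n - N) := by
  have hN := h.hNn
  have hsn := h.hsn
  have has := h.has
  have ha1 := h.ha1
  rw [wt_eq_sum, wt_eq_sum]
  change ∑ i ∈ Ico 1 (n+1), _ = _
  rw [Finset.sum_Ico_succ_top (by omega),
    ← Finset.sum_Ico_consecutive _ (show 1 ≤ s + 1 by omega) (show s + 1 ≤ n by omega)]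
  rw [Finset.sum_eq_zero (s := Ico (s+1) n), h.cnt_last hv]
  · have ham : a ∈ Icc 1 s := by simp; omega
    change ∑ i ∈ Icc 1 s, _ + 0 + _ = _
    have f := sum_full (h.gmaps hN le_rfl) (h.ginj hN le_rfl) (fun x => if x = v then 1 else 0)
    have f2 : ∑ r ∈ Icc 1 s, (if r = v then 1 else 0) = 1 := by
      rw [Finset.sum_ite_eq']
      simp; omega
    rw [f2] at f
    have aeq : rowCnt α T a v = rowCnt (shp α n a N) (ctr α T n N) a v := by
      unfold rowCnt
      have : shp α n a N a = α a := by simp [shp]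
      rw [this]
      congr 1
      refine Finset.filter_congr fun j hj => ?_
      simp at hj
      have := h.haN
      rw [ctr_eq, if_pos (by omega)]
    rw [← Finset.add_sum_erase _ _ ham] at f ⊢
    rw [← Finset.add_sum_erase _ (fun i => rowCnt (shp α n a N) (ctr α T n N) i v) ham, aeq]
    rw [Finset.sum_congr rfl (g := fun r => rowCnt (shp α n a N) (ctr α T n N) r v
      + (α n - N) * (if T r (α n) = v then 1 else 0))]
    · rw [Finset.sum_add_distrib, ← Finset.mul_sum]
      rw [Finset.sum_congr rfl (g := fun r => if T r (α n) = v then 1 else 0)] at f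
      · simp only [if_true] at f
        set A := ∑ r ∈ (Icc 1 s).erase a, if T r (α n) = v then 1 else 0
        have : (α n - N) * ((if T n (α n) = v then 1 else 0) + A) = α n - N := by rw [f, mul_one]
        rw [mul_add] at this
        omega
      · intro r hr
        rw [if_neg (Finset.ne_of_mem_erase hr)]
    · intro r hr
      have hr' := Finset.mem_of_mem_erase hr
      simp at hr'
      exact h.cnt_row hr'.1 hr'.2 (Finset.ne_of_mem_erase hr) v
  · intro i hi
    simp at hi
    refine rowCnt_zero fun j h1 h2 => ?_
    rw [h.mid i j (by omega) (by omega) h1 h2]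
    omega

theorem wt_ctr_zero (h : Sit n α T s a N) {v : ℕ} (hv : v = 0 ∨ s < v) :
    wtOf s (shp α n a N) (ctr α T n N) v = 0 := by
  rw [wt_eq_sum]
  refine Finset.sum_eq_zero fun i hi => rowCnt_zero fun j h1 h2 => ?_
  simp at hi
  have d : InD s (shp α n a N) i j := ⟨hi.1, hi.2, h1, h2⟩
  have := h.ctr_qkt.pos _ _ d
  have := h.ctr_qkt.rowBound _ _ d
  omega

end Sit

theorem stmt13 (n : ℕ) (α : ℕ → ℕ) (hpos : ∀ i, 1 ≤ i → i ≤ n → 1 ≤ α i)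
    (hav : AvoidsKM n α) (T S : ℕ → ℕ → ℕ) (hT : IsQKT n α T) (hS : IsQKT n α S)
    (hwt : ∀ v, wtOf n α T v = wtOf n α S v) :
    ∀ i j, InD n α i j → T i j = S i j := by
  induction n using Nat.strong_induction_on generalizing α T S with
  | _ n IH =>
  rcases Nat.eq_zero_or_pos n with hn | hn
  · intro i j d
    have := d.1
    have := d.2.1
    omega
  -- it suffices to treat the last row
  suffices hrow : ∀ j, 1 ≤ j → j ≤ α n → T n j = S n j by
    have hI := IH (n-1) (by omega) α (fun i h1 h2 => hpos i h1 (by omega))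
      (avoids_transfer (n := n) (by omega) hav (fun _ _ _ _ _ _ => Iff.rfl)
        (fun _ _ _ _ _ _ => le_rfl)) T S (restrict (by omega) hT) (restrict (by omega) hS)
      (by
        intro v
        have h := hwt v
        rw [wt_eq_sum, wt_eq_sum] at h ⊢
        obtain ⟨m, rfl⟩ : ∃ m, n = m + 1 := ⟨n-1, (Nat.sub_add_cancel hn).symm⟩
        rw [Finset.sum_Icc_succ_top (by omega), Finset.sum_Icc_succ_top (by omega),
          rowCnt_congr hrow v] at h
        simpa using h)
    intro i j d
    rcases Nat.lt_or_ge i n with h | h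
    · exact hI i j ⟨d.1, by omega, d.2.2⟩
    · have : i = n := le_antisymm d.2.1 h
      subst this
      exact hrow j d.2.2.1 d.2.2.2
  obtain ⟨s, hs1, hs2, hs3⟩ := exists_last (fun s => ∃ r, 1 ≤ r ∧ r < s ∧ α r < α s) (n-1)
  have hsn : s < n := by omega
  have mid : ∀ U, IsQKT n α U → ∀ r c, s < r → r < n → 1 ≤ c → c ≤ α r → U r c = r := by
    intro U hU r c h1 h2 h3 h4
    refine nonhigh hU hpos ⟨by omega, by omega, h3, h4⟩ fun r' h5 h6 => ?_
    by_contra hcon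
    exact hs3 r h1 (by omega) ⟨r', h5, h6, by omega⟩
  have hanti : ∀ U, IsQKT n α U → ∀ j j', 1 ≤ j → j ≤ j' → j' ≤ α n → U n j' ≤ U n j := by
    intro U hU j j' h1 h2 h3
    exact hU.rowDec _ _ _ ⟨hn, le_rfl, h1, by omega⟩ ⟨hn, le_rfl, by omega, h3⟩ h2
  have hbd : ∀ U, IsQKT n α U → ∀ j, 1 ≤ j → j ≤ α n → U n j ≤ n := by
    intro U hU j h1 h2
    exact hU.rowBound _ _ ⟨hn, le_rfl, h1, h2⟩
  have hcnt : ∀ v, s < v → rowCnt α T n v = rowCnt α S n v := by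
    intro v hv
    have h := hwt v
    rw [wt_eq_sum, wt_eq_sum] at h
    obtain ⟨m, rfl⟩ : ∃ m, n = m + 1 := ⟨n-1, (Nat.sub_add_cancel hn).symm⟩
    rw [Finset.sum_Icc_succ_top (by omega), Finset.sum_Icc_succ_top (by omega)] at h
    rw [Finset.sum_congr rfl (g := fun i => rowCnt α S i v)] at h
    · simpa using h
    · intro i hi
      simp at hi
      rcases Nat.lt_or_ge s i with h' | h'
      · refine rowCnt_congr (fun j h1 h2 => ?_) v
        rw [mid T hT i j h' (by omega) h1 h2, mid S hS i j h' (by omega) h1 h2]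
      · rw [rowCnt_zero, rowCnt_zero]
        · intro j h1 h2
          have := hS.rowBound i j ⟨hi.1, by omega, h1, h2⟩
          omega
        · intro j h1 h2
          have := hT.rowBound i j ⟨hi.1, by omega, h1, h2⟩
          omega
  have agree : ∀ c, 1 ≤ c → c ≤ α n → ∀ w, s < w → (w ≤ T n c ↔ w ≤ S n c) := by
    intro c h1 h2 w hw
    exact row_agree (f := T n) (g := S n) (hanti T hT) (hanti S hS) (hbd T hT) (hbd S hS)
      hcnt h1 h2 hw
  have agree' : ∀ c, 1 ≤ c → c ≤ α n → s < T n c → T n c = S n c := by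
    intro c h1 h2 h3
    have e1 := (agree c h1 h2 (T n c) h3).1 le_rfl
    have e2 := (agree c h1 h2 (S n c) (by omega)).2 le_rfl
    omega
  by_cases hcase : ∀ r, 1 ≤ r → r ≤ s → α n ≤ α r + 1
  · intro j h1 h2
    refine agree' j h1 h2 (fullplus hT hpos hsn le_rfl h1 h2 fun r h3 h4 => ?_)
    have := hcase r h3 h4
    omega
  push Not at hcase
  obtain ⟨a, ha1, has', hal⟩ := hcase
  obtain ⟨r₀, hr1, hr2, hr3⟩ : ∃ r, 1 ≤ r ∧ r < s ∧ α r < α s := by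
    rcases hs2 with h | h
    · omega
    · exact h
  have hsl : α n ≤ α s := by
    by_contra hcon
    exact av012 hav hr1 hr2 hsn le_rfl hr3 (by omega)
  have has : a < s := by
    rcases Nat.lt_or_ge a s with h | h
    · exact h
    · have : a = s := by omega
      subst this; omega
  have hlen : ∀ r, 1 ≤ r → r ≤ s → r ≠ a → α n ≤ α r := by
    intro r h1 h2 h3
    by_contra hcon
    have hrs : r ≠ s := by rintro rfl; omega
    rcases Nat.lt_or_ge a r with h | h
    · exact av4 hav ha1 h (show r < s by omega) hsn le_rfl (by omega) (by omega) hsl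
        (Or.inl (by omega))
    · exact av4 hav h1 (show r < a by omega) has hsn le_rfl (by omega) (by omega) hsl
        (Or.inr (by omega))
  by_cases hlast : s < T n (α n)
  · intro j h1 h2
    have := hanti T hT j (α n) h1 h2 le_rfl
    exact agree' j h1 h2 (by omega)
  -- the threshold
  obtain ⟨N, hNdef⟩ : ∃ N, N = ((Icc 1 (α n)).filter (fun j => s + 1 ≤ T n j)).card := ⟨_, rfl⟩
  have hNT : ∀ c, 1 ≤ c → c ≤ α n → (s + 1 ≤ T n c ↔ c ≤ N) := by
    intro c h1 h2
    rw [hNdef]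
    exact ge_iff (f := T n) (hanti T hT) h1 h2
  have hNS : ∀ c, 1 ≤ c → c ≤ α n → (s + 1 ≤ S n c ↔ c ≤ N) := by
    intro c h1 h2
    rw [← hNT c h1 h2, agree c h1 h2 _ (by omega)]
  have hNn : N < α n := by
    by_contra hcon
    exact hlast ((hNT (α n) (by omega) le_rfl).2 (by omega))
  have haN : α a < N := by
    have := fullplus hT hpos hsn le_rfl (c := α a + 1) (by omega) (by omega) (fun r h1 h2 => by
      by_cases e : r = a
      · subst e; omega
      · have := hlen r h1 h2 e; omega)
    have := (hNT (α a + 1) (by omega) (by omega)).1 (by omega)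
    omega
  have sit : ∀ U, IsQKT n α U → (∀ c, 1 ≤ c → c ≤ α n → (s + 1 ≤ U n c ↔ c ≤ N)) →
      Sit n α U s a N := by
    intro U hU h
    exact ⟨hU, hpos, ha1, has, hsn, haN, hNn, hlen,
      fun c h1 h2 => (h c h1 (by omega)).2 h2,
      fun c h1 h2 => by
        by_contra hcon
        have := (h c (by omega) h2).1 (by omega)
        omega, mid U hU⟩
  have sT := sit T hT hNT
  have sS := sit S hS hNS
  -- it suffices to compare the last entries
  suffices hend : T n (α n) = S n (α n) by
    intro j h1 h2
    rcases Nat.lt_or_ge N j with h | h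
    · rw [sT.nconst h h2, sS.nconst h h2, hend]
    · exact agree' j h1 h2 (sT.big j h1 h)
  rcases Nat.lt_or_ge (α n) (α s) with hlt | hge
  swap
  · rw [sT.last_eq_s (by omega), sS.last_eq_s (by omega)]
  -- contraction
  have hI := IH s hsn (shp α n a N)
    (by
      intro i h1 h2
      unfold shp
      split_ifs with e
      · exact hpos a ha1 (by omega)
      · have := hlen i h1 h2 e; omega)
    (by
      refine avoids_transfer (n := n) hsn.le hav
        (fun i j h1 h2 h3 h4 => sT.shp_lt h1 h2 h3 h4) ?_
      intro i j h1 h2 h3 h4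
      have l1 := hlen i h1 h2
      have l2 := hlen j h3 h4
      have e1 : i ≠ a → ((shp α n a N i : ℕ) : ℤ) = α i - (α n - N) := by
        intro e
        have := l1 e
        simp only [shp, e, if_false]
        omega
      have e2 : j ≠ a → ((shp α n a N j : ℕ) : ℤ) = α j - (α n - N) := by
        intro e
        have := l2 e
        simp only [shp, e, if_false]
        omega
      have e0 : shp α n a N a = α a := by simp [shp]
      by_cases ei : i = a <;> by_cases ej : j = a
      · rw [ei, ej]; simp
      · rw [ei, e0, e2 ej]
        have := l2 ej
        rw [abs_of_nonpos (by omega), abs_of_nonpos (by omega)]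
        omega
      · rw [ej, e0, e1 ei]
        have := l1 ei
        rw [abs_of_nonneg (by omega), abs_of_nonneg (by omega)]
        omega
      · rw [e1 ei, e2 ej]
        apply le_of_eq
        congr 1
        ring)
    (ctr α T n N) (ctr α S n N) sT.ctr_qkt sS.ctr_qkt
    (by
      intro v
      by_cases hv : v = 0 ∨ s < v
      · rw [sT.wt_ctr_zero hv, sS.wt_ctr_zero hv]
      · push Not at hv
        have h := hwt v
        rw [sT.wt_ctr (by omega) hv.2, sS.wt_ctr (by omega) hv.2] at h
        omega)
  have hrows : ∀ r, 1 ≤ r → r ≤ s → r ≠ a → T r (α n) = S r (α n) := by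
    intro r h1 h2 h3
    have hl := hlen r h1 h2 h3
    rcases Nat.lt_or_ge r a with h | h
    · have d : InD n α r (α n) := ⟨h1, by omega, by omega, hl⟩
      rw [nonhigh hT hpos d (fun r' h4 h5 => hlen r' h4 (by omega) (by omega)),
        nonhigh hS hpos d (fun r' h4 h5 => hlen r' h4 (by omega) (by omega))]
    · have hl' : α n < α r := by
        by_contra hcon
        have hrs : r ≠ s := by rintro rfl; omega
        exact av012 hav ha1 (show a < r by omega) (show r < s by omega) hsn.le (by omega) (by omega)
      have d : InD s (shp α n a N) r (N+1) := by
        refine ⟨h1, h2, by omega, ?_⟩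
        unfold shp
        rw [if_neg h3]
        omega
      have := hI r (N+1) d
      rw [(sT.ctr_next d).1, (sS.ctr_next d).1] at this
      rw [← sT.rconst h1 h2 h3 (c := N+1) (by omega) (by omega),
        ← sS.rconst h1 h2 h3 (c := N+1) (by omega) (by omega), this]
  -- the missing value
  have f1 := sum_full (sT.gmaps hNn le_rfl) (sT.ginj hNn le_rfl) id
  have f2 := sum_full (sS.gmaps hNn le_rfl) (sS.ginj hNn le_rfl) id
  have f := f1.trans f2.symm
  have ham : a ∈ Icc 1 s := by simp; omega
  rw [← Finset.add_sum_erase _ _ ham,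
    ← Finset.add_sum_erase _ (fun r => id (if r = a then S n (α n) else S r (α n))) ham] at f
  rw [Finset.sum_congr rfl (g := fun r => id (if r = a then S n (α n) else S r (α n)))] at f
  · simpa using f
  · intro r hr
    have hne := Finset.ne_of_mem_erase hr
    have hr' := Finset.mem_of_mem_erase hr
    simp at hr'
    simp only [id, if_neg hne]
    exact hrows r hr'.1 hr'.2 hne
end
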